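/- Let Ω(n,p) be a K-invariant open subset of J^k(n,p), and let (K,L) be a pair consisting of a finite simplicial complex K and a subcomplex L such that K∖L is a manifold, dim L < dim K, and dim K < p. Let ψ : (K,L) → (Ω_K(n+1,p+1), i_{+1}(Ω(n,p))) be a continuous map of pairs such that ψ restricted to K∖L is smooth. Then there exists a homotopy ψ_λ : (K,L) → (Ω_K(n+1,p+1), i_{+1}(Ω(n,p))) with (i) ψ_0 = ψ, (ii) ψ_λ|L = ψ|L for all λ, and (iii) pr_{p+1}(π^k_1 ∘ ψ_1(u))(x_1,…,x_{n+1}) = x_{n+1} for every u ∈ K, i.e. the last target component of the 1-jet part of ψ_1(u) is the linear coordinate function x_{n+1}. -/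

import Mathlib

open scoped Topology unitInterval
open Filter Asymptotics
open scoped Manifold

namespace AndoCob


/-! ### Jet spaces -/

/-- The space of `k`-jets at the origin of smooth map germs `(ℝⁿ,0) → (ℝᵖ,0)`,
modeled by `p`-tuples of real polynomials in `n` variables with vanishing constant
term and total degree at most `k`.  This realizes
`J^k(n,p) = ⊕_{i=1}^k Hom(Sⁱ(ℝⁿ), ℝᵖ)`. -/
def JetSpace (k n p : ℕ) : Type :=
  { z : Fin p → MvPolynomial (Fin n) ℝ //
    ∀ j, (z j).totalDegree ≤ k ∧ MvPolynomial.constantCoeff (z j) = 0 }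

/-- The (finitely many) coefficients of a jet. -/
noncomputable def jetCoeffs {k n p : ℕ} (z : JetSpace k n p) :
    Fin p → (Fin n → Fin (k + 1)) → ℝ := fun j e =>
  MvPolynomial.coeff (Finsupp.equivFunOnFinite.symm fun i => (e i : ℕ)) (z.1 j)

/-- The (euclidean) topology on a jet space, induced by the coefficients. -/
noncomputable instance {k n p : ℕ} : TopologicalSpace (JetSpace k n p) :=
  TopologicalSpace.induced jetCoeffs inferInstance

/-- Evaluation of the polynomial representative of a jet. -/
noncomputable def JetSpace.eval {k n p : ℕ} (z : JetSpace k n p) (x : Fin n → ℝ) :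
    Fin p → ℝ := fun j => MvPolynomial.eval x (z.1 j)

/-- `z` is the `k`-jet at `0` of the map `f` : `f` agrees with the polynomial
representative of `z` to order `> k` at the origin. -/
def IsJetAt {k n p : ℕ} (z : JetSpace k n p) (f : (Fin n → ℝ) → Fin p → ℝ) : Prop :=
  (fun x => f x - z.eval x) =o[𝓝 (0 : Fin n → ℝ)] fun x => ‖x‖ ^ k

/-- `z` is the `k`-jet at `0` of `f` along the set `s` (for manifolds with boundary). -/
def IsJetWithinAt {k n p : ℕ} (z : JetSpace k n p) (f : (Fin n → ℝ) → Fin p → ℝ)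
    (s : Set (Fin n → ℝ)) : Prop :=
  (fun x => f x - z.eval x) =o[𝓝[s] (0 : Fin n → ℝ)] fun x => ‖x‖ ^ k

/-! ### Germs at the origin, diffeomorphism germs, contact equivalence -/

/-- `f` is smooth on a neighbourhood of the origin. -/
def SmoothGermAtZero {n p : ℕ} (f : (Fin n → ℝ) → Fin p → ℝ) : Prop :=
  ∃ U ∈ 𝓝 (0 : Fin n → ℝ), ContDiffOn ℝ (⊤ : ℕ∞) f U

/-- `h` is (a representative of) a germ of diffeomorphism of `(ℝⁿ,0)`:
it fixes the origin, is smooth near the origin and its differential at the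
origin is invertible (by the inverse function theorem this is equivalent to
being a diffeomorphism germ). -/
def DiffeoGermAtZero {n : ℕ} (h : (Fin n → ℝ) → Fin n → ℝ) : Prop :=
  h 0 = 0 ∧ SmoothGermAtZero h ∧ Function.Bijective (fderiv ℝ h 0)

/-- Contact (Mather's group `𝒦`) equivalence of two map germs:
`g x = M x • f (h x)` near the origin, for a diffeomorphism germ `h` of the
source and a smooth germ `M` of invertible matrices. -/
def KEquivGerm {n p : ℕ} (f g : (Fin n → ℝ) → Fin p → ℝ) : Prop :=
  ∃ (h : (Fin n → ℝ) → Fin n → ℝ) (M : (Fin n → ℝ) → Matrix (Fin p) (Fin p) ℝ),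
    DiffeoGermAtZero h ∧
    (∃ U ∈ 𝓝 (0 : Fin n → ℝ), ContDiffOn ℝ (⊤ : ℕ∞) (fun x (i : Fin p) (j : Fin p) => M x i j) U) ∧
    IsUnit (M 0) ∧
    (∀ᶠ x in 𝓝 (0 : Fin n → ℝ), g x = (M x).mulVec (f (h x)))

/-- Contact equivalence of `k`-jets: the jets admit smooth representatives
that are `𝒦`-equivalent as germs. -/
def KEquiv {k n p : ℕ} (z w : JetSpace k n p) : Prop :=
  ∃ f g : (Fin n → ℝ) → Fin p → ℝ,
    SmoothGermAtZero f ∧ SmoothGermAtZero g ∧ f 0 = 0 ∧ g 0 = 0 ∧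
    IsJetAt z f ∧ IsJetAt w g ∧ KEquivGerm f g

/-- The `𝒦`-orbit of a jet. -/
def KOrbit {k n p : ℕ} (z : JetSpace k n p) : Set (JetSpace k n p) := {w | KEquiv z w}

/-- A set of jets invariant under the contact group. -/
def KInvariant {k n p : ℕ} (Ω : Set (JetSpace k n p)) : Prop :=
  ∀ z ∈ Ω, ∀ w, KEquiv z w → w ∈ Ω

/-- Right-left equivalence of jets (the action of `L^k(p) × L^k(n)`):
the jets admit smooth representatives `f`, `g` with `g = ψ ∘ f ∘ φ` near `0`
for diffeomorphism germs `φ` of `(ℝⁿ,0)` and `ψ` of `(ℝᵖ,0)`. -/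
def RLEquiv {k n p : ℕ} (z w : JetSpace k n p) : Prop :=
  ∃ (f g : (Fin n → ℝ) → Fin p → ℝ) (φ : (Fin n → ℝ) → Fin n → ℝ)
    (ψ : (Fin p → ℝ) → Fin p → ℝ),
    SmoothGermAtZero f ∧ SmoothGermAtZero g ∧ f 0 = 0 ∧ g 0 = 0 ∧
    DiffeoGermAtZero φ ∧ DiffeoGermAtZero ψ ∧
    IsJetAt z f ∧ IsJetAt w g ∧ (∀ᶠ x in 𝓝 (0 : Fin n → ℝ), g x = ψ (f (φ x)))

/-- Invariance under the action of `L^k(p) × L^k(n)`. -/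
def LInvariant {k n p : ℕ} (Ω : Set (JetSpace k n p)) : Prop :=
  ∀ z ∈ Ω, ∀ w, RLEquiv z w → w ∈ Ω



/-! ### Truncation and algebraic operations on jets -/

/-- Truncation of a polynomial: keep only the monomials of degree between `1` and `k`. -/
noncomputable def truncPoly (k : ℕ) {n : ℕ} (φ : MvPolynomial (Fin n) ℝ) :
    MvPolynomial (Fin n) ℝ :=
  ∑ d ∈ φ.support.filter fun d : Fin n →₀ ℕ =>
      1 ≤ (d.sum fun _ e => e) ∧ (d.sum fun _ e => e) ≤ k,
    MvPolynomial.monomial d (MvPolynomial.coeff d φ)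

theorem truncPoly_totalDegree_le (k : ℕ) {n : ℕ} (φ : MvPolynomial (Fin n) ℝ) :
    (truncPoly k φ).totalDegree ≤ k := by
  classical
  refine le_trans (MvPolynomial.totalDegree_finset_sum _ _) ?_
  refine Finset.sup_le fun d hd => ?_
  simp only [Finset.mem_filter] at hd
  refine le_trans (MvPolynomial.totalDegree_monomial_le _ _) ?_
  simpa [Finsupp.sum] using hd.2.2

theorem truncPoly_constantCoeff (k : ℕ) {n : ℕ} (φ : MvPolynomial (Fin n) ℝ) :
    MvPolynomial.constantCoeff (truncPoly k φ) = 0 := by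
  classical
  rw [truncPoly, map_sum]
  refine Finset.sum_eq_zero fun d hd => ?_
  simp only [Finset.mem_filter] at hd
  have hd0 : d ≠ 0 := by
    intro h
    rw [h] at hd
    simp [Finsupp.sum_zero_index] at hd
  simp [MvPolynomial.constantCoeff_monomial, hd0]

/-- Build a jet from an arbitrary tuple of polynomials by truncation. -/
noncomputable def truncJet (k n p : ℕ) (q : Fin p → MvPolynomial (Fin n) ℝ) :
    JetSpace k n p :=
  ⟨fun j => truncPoly k (q j), fun j =>
    ⟨truncPoly_totalDegree_le k (q j), truncPoly_constantCoeff k (q j)⟩⟩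

/-- Precomposition of a jet with the linear map `x ↦ A x`, `A : Matrix (Fin m) (Fin m') ℝ`
(substituting the `i`-th variable by the linear form `∑ i', A i i' • X i'`). -/
noncomputable def jetPrecomp {k m p : ℕ} {m' : ℕ} (A : Matrix (Fin m) (Fin m') ℝ)
    (z : JetSpace k m p) : JetSpace k m' p :=
  truncJet k m' p fun j =>
    MvPolynomial.aeval (fun i : Fin m => ∑ i', MvPolynomial.C (A i i') * MvPolynomial.X i')
      (z.1 j)

/-- Postcomposition of a jet with the linear map given by `B : Matrix (Fin q) (Fin p) ℝ`. -/
noncomputable def jetPostcomp {k m p q : ℕ} (B : Matrix (Fin q) (Fin p) ℝ)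
    (z : JetSpace k m p) : JetSpace k m q :=
  truncJet k m q fun j => ∑ j', MvPolynomial.C (B j j') * z.1 j'

/-! ### The stabilization `i₊` -/

/-- The map `i_{+1} : J^k(n,p) → J^k(n+1,p+1)`, `j^k₀ f ↦ j^k₀ (f × id_ℝ)`. -/
noncomputable def iPlusOne {k n p : ℕ} (hk : 1 ≤ k) (z : JetSpace k n p) :
    JetSpace k (n + 1) (p + 1) :=
  ⟨Fin.snoc (fun j => MvPolynomial.rename Fin.castSucc (z.1 j))
      (MvPolynomial.X (Fin.last n)), by
    intro j
    refine Fin.lastCases ?_ (fun j => ?_) j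
    · constructor
      · simpa [Fin.snoc_last] using hk
      · simp [Fin.snoc_last]
    · simp only [Fin.snoc_castSucc]
      exact ⟨le_trans (MvPolynomial.totalDegree_rename_le _ _) (z.2 j).1, by
        simp [MvPolynomial.constantCoeff_rename, (z.2 j).2]⟩⟩

/-- The iterated stabilization `i_{+m} : J^k(n,p) → J^k(n+m,p+m)`. -/
noncomputable def iPlus {k n p : ℕ} (hk : 1 ≤ k) :
    (m : ℕ) → JetSpace k n p → JetSpace k (n + m) (p + m)
  | 0 => id
  | m + 1 => fun z => iPlusOne hk (iPlus hk m z)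


/-- `Ω_𝒦(n+m,p+m)` : the union of all `𝒦`-orbits `𝒦(i_{+m}(z))` for `z ∈ Ω(n,p)`. -/
def OmegaK {k n p : ℕ} (hk : 1 ≤ k) (Ω : Set (JetSpace k n p)) (m : ℕ) :
    Set (JetSpace k (n + m) (p + m)) :=
  {w | ∃ z ∈ Ω, KEquiv (iPlus hk m z) w}

/-- The linear part (first differential at the origin) of a jet. -/
noncomputable def jetLinearPart {k m q : ℕ} (z : JetSpace k m q) :
    Matrix (Fin q) (Fin m) ℝ :=
  Matrix.of fun j i => MvPolynomial.coeff (Finsupp.single i 1) (z.1 j)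

/-- `Σ^i(m,q)` : the jets whose linear part has kernel of dimension exactly `i`. -/
def SigmaI {k : ℕ} (m q i : ℕ) : Set (JetSpace k m q) :=
  {z | Module.finrank ℝ (LinearMap.ker (jetLinearPart z).mulVecLin) = i}

/-! ### Statement: Lemma 6.1 -/




theorem monom_bound {n : ℕ} (d : Fin n →₀ ℕ) (x : Fin n → ℝ) :
    ‖∏ i, x i ^ d i‖ ≤ ‖x‖ ^ d.degree := by
  rw [norm_prod, Finsupp.degree_eq_sum, ← Finset.prod_pow_eq_pow_sum]
  refine Finset.prod_le_prod (fun _ _ => norm_nonneg _) fun i _ => ?_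
  rw [norm_pow]
  exact pow_le_pow_left₀ (norm_nonneg _) (norm_le_pi_norm x i) _

theorem poly_isLittleO {k n : ℕ} (P : MvPolynomial (Fin n) ℝ)
    (h : ∀ d : Fin n →₀ ℕ, d.degree ≤ k → MvPolynomial.coeff d P = 0) :
    (fun x => MvPolynomial.eval x P) =o[𝓝 (0 : Fin n → ℝ)] fun x => ‖x‖ ^ k := by
  simp only [MvPolynomial.eval_eq']
  refine IsLittleO.fun_sum fun d hd => ?_
  have hdk : k < d.degree := by
    by_contra hc
    exact (MvPolynomial.mem_support_iff.1 hd) (h d (not_lt.1 hc))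
  refine IsLittleO.const_mul_left ?_ _
  refine IsBigO.trans_isLittleO (g := fun x : Fin n → ℝ => ‖x‖ ^ d.degree) ?_ ?_
  · refine IsBigO.of_bound 1 (Eventually.of_forall fun x => ?_)
    simpa using monom_bound d x
  · exact isLittleO_norm_pow_norm_pow hdk

theorem coeff_truncPoly (k : ℕ) {n : ℕ} (φ : MvPolynomial (Fin n) ℝ) (d : Fin n →₀ ℕ) :
    MvPolynomial.coeff d (truncPoly k φ) =
      if 1 ≤ d.degree ∧ d.degree ≤ k then MvPolynomial.coeff d φ else 0 := by
  classical
  have hdeg : (d.sum fun _ e => e) = d.degree := rfl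
  rw [truncPoly, MvPolynomial.coeff_sum]
  simp only [MvPolynomial.coeff_monomial]
  rw [Finset.sum_ite_eq']
  simp only [Finset.mem_filter, hdeg, MvPolynomial.mem_support_iff]
  by_cases h0 : MvPolynomial.coeff d φ = 0 <;> simp [h0]

theorem coeff_jet_zero {k n p : ℕ} (z : JetSpace k n p) (j : Fin p) :
    MvPolynomial.coeff 0 (z.1 j) = 0 := (z.2 j).2

theorem coeff_jet_big {k n p : ℕ} (z : JetSpace k n p) (j : Fin p) (d : Fin n →₀ ℕ)
    (hd : k < d.degree) : MvPolynomial.coeff d (z.1 j) = 0 := by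
  apply MvPolynomial.coeff_eq_zero_of_totalDegree_lt
  exact lt_of_le_of_lt (z.2 j).1 hd

theorem eval_zero {n : ℕ} (P : MvPolynomial (Fin n) ℝ) :
    MvPolynomial.eval (0 : Fin n → ℝ) P = MvPolynomial.coeff 0 P := by
  rw [MvPolynomial.eval_zero, MvPolynomial.constantCoeff_eq]

theorem truncJet_self {k n p : ℕ} (z : JetSpace k n p) : truncJet k n p z.1 = z := by
  apply Subtype.ext
  funext j
  ext d
  simp only [truncJet, coeff_truncPoly]
  split_ifs with h
  · rfl
  · rcases Nat.eq_zero_or_pos d.degree with h0 | h0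
    · rw [(Finsupp.degree_eq_zero_iff d).1 h0, coeff_jet_zero]
    · rw [coeff_jet_big z j d (by omega)]

theorem isJetAt_iff {k n p : ℕ} {z : JetSpace k n p} {f : (Fin n → ℝ) → Fin p → ℝ} :
    IsJetAt z f ↔ ∀ j, (fun x => f x j - MvPolynomial.eval x (z.1 j)) =o[𝓝 (0 : Fin n → ℝ)]
      fun x => ‖x‖ ^ k := by
  rw [IsJetAt, isLittleO_pi]
  rfl

theorem isJetAt_truncJet {k n p : ℕ} {q : Fin p → MvPolynomial (Fin n) ℝ}
    {f : (Fin n → ℝ) → Fin p → ℝ} (h0 : ∀ j, MvPolynomial.coeff 0 (q j) = 0)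
    (hf : ∀ j, (fun x => f x j - MvPolynomial.eval x (q j)) =o[𝓝 (0 : Fin n → ℝ)]
      fun x => ‖x‖ ^ k) : IsJetAt (truncJet k n p q) f := by
  rw [isJetAt_iff]
  intro j
  have h2 : (fun x => MvPolynomial.eval x (q j - truncPoly k (q j))) =o[𝓝 (0 : Fin n → ℝ)]
      fun x => ‖x‖ ^ k := by
    apply poly_isLittleO
    intro d hd
    rw [MvPolynomial.coeff_sub, coeff_truncPoly]
    split_ifs with h
    · simp
    · have : d = 0 := by
        rw [← Finsupp.degree_eq_zero_iff]; omega
      simp [this, h0]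
  refine ((hf j).add h2).congr_left fun x => ?_
  simp [truncJet]

/-- uniqueness of jets -/
theorem univ_unique {k : ℕ} (P : Polynomial ℝ) (hd : P.natDegree ≤ k)
    (h : (fun t => P.eval t) =o[𝓝 (0 : ℝ)] fun t => t ^ k) : P = 0 := by
  by_contra hP
  obtain ⟨q, hq, hq0⟩ := Polynomial.exists_eq_pow_rootMultiplicity_mul_and_not_dvd P hP 0
  set m := Polynomial.rootMultiplicity 0 P
  have hq1 : q.eval 0 ≠ 0 := by
    intro hc
    exact hq0 (Polynomial.dvd_iff_isRoot.2 hc)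
  have hqne : q ≠ 0 := by rintro rfl; simp at hq1
  have hm : m ≤ k := by
    refine le_trans ?_ hd
    rw [hq, Polynomial.natDegree_mul (pow_ne_zero _ (Polynomial.X_sub_C_ne_zero 0)) hqne,
      Polynomial.natDegree_pow, Polynomial.natDegree_X_sub_C]
    omega
  have h1 : (fun t : ℝ => P.eval t) =o[𝓝 (0 : ℝ)] fun t => t ^ m := by
    refine h.trans_isBigO ?_
    rcases hm.lt_or_eq with hm | hm
    · exact (isLittleO_pow_pow hm).isBigO
    · rw [hm]
  have h2 : (fun t : ℝ => q.eval t) =o[𝓝[≠] (0 : ℝ)] fun _ => (1 : ℝ) := by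
    have h3 := h1.mono (nhdsWithin_le_nhds (s := {0}ᶜ))
    rw [isLittleO_iff] at h3 ⊢
    intro c hc
    filter_upwards [h3 hc, self_mem_nhdsWithin] with t ht ht0
    rw [hq] at ht
    simp only [Polynomial.eval_mul, Polynomial.eval_pow, Polynomial.eval_sub, Polynomial.eval_X,
      Polynomial.eval_C, sub_zero, norm_mul] at ht
    have : 0 < ‖t ^ m‖ := norm_pos_iff.2 (pow_ne_zero _ ht0)
    rw [mul_comm] at ht
    simpa using le_of_mul_le_mul_right ht this
  rw [isLittleO_one_iff] at h2
  have h4 : Tendsto (fun t : ℝ => q.eval t) (𝓝[≠] 0) (𝓝 (q.eval 0)) :=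
    (q.continuous.tendsto 0).mono_left nhdsWithin_le_nhds
  exact hq1 (tendsto_nhds_unique h4 h2)

theorem poly_unique {k n : ℕ} (P : MvPolynomial (Fin n) ℝ) (hd : P.totalDegree ≤ k)
    (h : (fun x => MvPolynomial.eval x P) =o[𝓝 (0 : Fin n → ℝ)] fun x => ‖x‖ ^ k) : P = 0 := by
  apply MvPolynomial.funext
  intro x
  rw [map_zero]
  set Q : Polynomial ℝ := MvPolynomial.aeval (fun i => Polynomial.C (x i) * Polynomial.X) P with hQ
  have hev : ∀ t : ℝ, Q.eval t = MvPolynomial.eval (t • x) P := by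
    intro t
    rw [hQ, ← Polynomial.coe_evalRingHom, ← MvPolynomial.eval₂_id, MvPolynomial.aeval_def,
      MvPolynomial.hom_eval₂]
    congr 1
    · ext; simp
    · funext i
      rw [Polynomial.coe_evalRingHom, Polynomial.eval_mul, Polynomial.eval_C, Polynomial.eval_X,
        Pi.smul_apply, smul_eq_mul, mul_comm]
  have hQd : Q.natDegree ≤ k := by
    rw [hQ, MvPolynomial.aeval_def, MvPolynomial.eval₂_eq']
    refine Polynomial.natDegree_sum_le_of_forall_le _ _ fun d hd' => ?_
    have hdk : d.degree ≤ k := le_trans (MvPolynomial.le_totalDegree hd') hd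
    refine le_trans (Polynomial.natDegree_C_mul_le _ _) ?_
    refine le_trans (Polynomial.natDegree_prod_le _ _) ?_
    refine le_trans ?_ hdk
    rw [Finsupp.degree_eq_sum]
    refine Finset.sum_le_sum fun i _ => ?_
    refine le_trans Polynomial.natDegree_pow_le ?_
    have : (Polynomial.C (x i) * Polynomial.X).natDegree ≤ 1 := by
      simpa using Polynomial.natDegree_C_mul_X_pow_le (x i) 1
    nlinarith
  have hQ0 : Q = 0 := by
    refine univ_unique Q hQd ?_
    have ht : Tendsto (fun t : ℝ => t • x) (𝓝 0) (𝓝 0) := by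
      have : Continuous fun t : ℝ => t • x := by fun_prop
      simpa using this.tendsto 0
    have h1 := h.comp_tendsto ht
    have h2 : (fun t : ℝ => Q.eval t) =o[𝓝 0] fun t => ‖t • x‖ ^ k :=
      h1.congr_left fun t => (hev t).symm
    refine h2.trans_isBigO ?_
    refine IsBigO.of_bound (‖x‖ ^ k) (Eventually.of_forall fun t => ?_)
    rw [norm_smul, mul_pow, norm_mul, norm_pow, norm_pow, norm_pow, norm_norm, norm_norm, mul_comm]
  have := hev 1
  rw [hQ0] at this
  simpa using this.symm

theorem jet_unique {k n p : ℕ} {z w : JetSpace k n p} {f : (Fin n → ℝ) → Fin p → ℝ}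
    (hz : IsJetAt z f) (hw : IsJetAt w f) : z = w := by
  rw [isJetAt_iff] at hz hw
  apply Subtype.ext
  funext j
  rw [← sub_eq_zero]
  refine poly_unique (k := k) _ ?_ ?_
  · exact le_trans (MvPolynomial.totalDegree_sub _ _) (max_le (z.2 j).1 (w.2 j).1)
  · refine ((hw j).sub (hz j)).congr_left fun x => ?_
    simp


theorem hda_congr {f g : ℝ → ℝ} {a b t : ℝ} (h : HasDerivAt f a t) (hf : ∀ t, g t = f t)
    (hab : b = a) : HasDerivAt g b t := by
  have : g = f := funext hf
  rw [this, hab]; exact h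

theorem poly_integrate {n : ℕ} (Q : MvPolynomial (Fin n) ℝ) : ∃ R : MvPolynomial (Fin n) ℝ,
    ∀ (x : Fin n → ℝ) (t : ℝ), HasDerivAt (fun t : ℝ => t * MvPolynomial.eval (t • x) R)
      (MvPolynomial.eval (t • x) Q) t := by
  induction Q using MvPolynomial.induction_on' with
  | monomial d a =>
    refine ⟨MvPolynomial.monomial d (a / (d.degree + 1)), fun x t => ?_⟩
    have hev : ∀ (b t : ℝ), MvPolynomial.eval (t • x) (MvPolynomial.monomial d b) =
        t ^ d.degree * (b * ∏ i, x i ^ d i) := by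
      intro b t
      rw [MvPolynomial.eval_monomial, Finsupp.prod_fintype _ _ (by simp)]
      simp only [Pi.smul_apply, smul_eq_mul, mul_pow]
      rw [Finset.prod_mul_distrib, Finset.prod_pow_eq_pow_sum, ← Finsupp.degree_eq_sum]
      ring
    simp only [hev]
    have h1 := ((hasDerivAt_pow (d.degree + 1) t).mul_const
      (a / (d.degree + 1) * ∏ i, x i ^ d i))
    have hne : (d.degree : ℝ) + 1 ≠ 0 := by positivity
    refine hda_congr h1 (fun t => ?_) ?_
    · ring
    · push_cast
      field_simp
  | add p q hp hq =>
    obtain ⟨R, hR⟩ := hp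
    obtain ⟨S, hS⟩ := hq
    refine ⟨R + S, fun x t => ?_⟩
    refine hda_congr ((hR x t).add (hS x t)) (fun t => ?_) ?_
    · simp [mul_add]
    · simp

theorem taylor_exists {n : ℕ} (k : ℕ) : ∀ f : (Fin n → ℝ) → ℝ,
    ContDiffAt ℝ (⊤ : ℕ∞) f 0 → ∃ P : MvPolynomial (Fin n) ℝ,
      (fun x => f x - MvPolynomial.eval x P) =o[𝓝 (0 : Fin n → ℝ)] fun x => ‖x‖ ^ k := by
  induction k with
  | zero =>
    intro f hf
    refine ⟨MvPolynomial.C (f 0), ?_⟩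
    simp only [pow_zero, MvPolynomial.eval_C]
    rw [isLittleO_one_iff]
    have : Tendsto (fun x => f x - f 0) (𝓝 0) (𝓝 (f 0 - f 0)) :=
      hf.continuousAt.tendsto.sub tendsto_const_nhds
    simpa using this
  | succ k ih =>
    intro f hf
    have hfi : ∀ i : Fin n, ContDiffAt ℝ (⊤ : ℕ∞) (fun x => fderiv ℝ f x (Pi.single i 1)) 0 := by
      intro i
      exact (hf.fderiv_right (m := (⊤ : ℕ∞)) (by norm_cast)).clm_apply contDiffAt_const
    choose Q hQ using fun i => ih _ (hfi i)
    choose R hR using fun i => poly_integrate (Q i)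
    refine ⟨MvPolynomial.C (f 0) + ∑ i, MvPolynomial.X i * R i, ?_⟩
    rw [isLittleO_iff]
    intro c hc
    have hc' : 0 < c / (n + 1) := by positivity
    have hdiff : ∀ᶠ y in 𝓝 (0 : Fin n → ℝ), DifferentiableAt ℝ f y := by
      have h1 : ContDiffAt ℝ 1 f 0 := hf.of_le (by norm_cast)
      filter_upwards [h1.eventually (by simp)] with y hy
      exact hy.differentiableAt (by simp)
    have hall : ∀ᶠ y in 𝓝 (0 : Fin n → ℝ), ∀ i,
        ‖fderiv ℝ f y (Pi.single i 1) - MvPolynomial.eval y (Q i)‖ ≤ c / (n + 1) * ‖y‖ ^ k := by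
      rw [eventually_all]
      intro i
      have := (isLittleO_iff.1 (hQ i)) hc'
      simpa using this
    obtain ⟨δ, hδ, hball⟩ := Metric.eventually_nhds_iff_ball.1 (hdiff.and hall)
    filter_upwards [Metric.ball_mem_nhds (0 : Fin n → ℝ) hδ] with x hx
    set φ : ℝ → ℝ := fun t => f (t • x) -
      MvPolynomial.eval (t • x) (MvPolynomial.C (f 0) + ∑ i, MvPolynomial.X i * R i) with hφ
    have hφ' : φ = fun t => f (t • x) -
        (f 0 + ∑ i, x i * (t * MvPolynomial.eval (t • x) (R i))) := by
      funext t
      simp only [hφ, map_add, map_sum, map_mul, MvPolynomial.eval_C, MvPolynomial.eval_X,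
        Pi.smul_apply, smul_eq_mul]
      congr 2
      refine Finset.sum_congr rfl fun i _ => ?_
      ring
    have hin : ∀ t ∈ Set.Icc (0 : ℝ) 1, ‖t • x‖ ≤ ‖x‖ := by
      intro t ht
      rw [norm_smul, Real.norm_of_nonneg ht.1]
      exact mul_le_of_le_one_left (norm_nonneg _) ht.2
    have hinb : ∀ t ∈ Set.Icc (0 : ℝ) 1, t • x ∈ Metric.ball (0 : Fin n → ℝ) δ := by
      intro t ht
      rw [mem_ball_zero_iff] at hx ⊢
      exact lt_of_le_of_lt (hin t ht) hx
    have hder : ∀ t ∈ Set.Icc (0 : ℝ) 1, HasDerivAt φ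
        (∑ i, x i * (fderiv ℝ f (t • x) (Pi.single i 1) - MvPolynomial.eval (t • x) (Q i))) t := by
      intro t ht
      have h1 : HasDerivAt (fun t : ℝ => t • x) x t := by
        simpa using (hasDerivAt_id t).smul_const x
      have h2 := (hball _ (hinb t ht)).1.hasFDerivAt.comp_hasDerivAt t h1
      have h3 : HasDerivAt (fun t : ℝ => f 0 + ∑ i, x i * (t * MvPolynomial.eval (t • x) (R i)))
          (∑ i, x i * MvPolynomial.eval (t • x) (Q i)) t :=
        (HasDerivAt.fun_sum fun i _ => (hR i x t).const_mul (x i)).const_add _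
      rw [hφ']
      refine hda_congr (h2.sub h3) (fun t => rfl) ?_
      rw [← Finset.sum_congr rfl fun i _ => (mul_sub _ _ _).symm, Finset.sum_sub_distrib]
      congr 1
      have := (fderiv ℝ f (t • x)).toLinearMap.pi_apply_eq_sum_univ x
      simp only [ContinuousLinearMap.coe_coe, smul_eq_mul] at this
      rw [this]
      refine Finset.sum_congr rfl fun i _ => ?_
      congr 2
      funext j
      simp [Pi.single_apply, eq_comm]
    have hmv := norm_image_sub_le_of_norm_deriv_le_segment_01' (f := φ)
      (C := c * ‖x‖ ^ (k + 1)) (fun t ht => (hder t ht).hasDerivWithinAt) (by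
        intro t ht
        have ht' := Set.Ico_subset_Icc_self ht
        refine le_trans (norm_sum_le _ _) ?_
        have hb : ∀ i ∈ (Finset.univ : Finset (Fin n)),
            ‖x i * (fderiv ℝ f (t • x) (Pi.single i 1) - MvPolynomial.eval (t • x) (Q i))‖ ≤
              c / (n + 1) * ‖x‖ ^ (k + 1) := by
          intro i _
          rw [norm_mul]
          calc _ ≤ ‖x‖ * (c / (n + 1) * ‖t • x‖ ^ k) :=
                mul_le_mul (norm_le_pi_norm x i) ((hball _ (hinb t ht')).2 i) (norm_nonneg _)
                  (norm_nonneg _)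
            _ ≤ ‖x‖ * (c / (n + 1) * ‖x‖ ^ k) := by
                have := hin t ht'
                gcongr
            _ = _ := by ring
        refine le_trans (Finset.sum_le_sum hb) ?_
        rw [Finset.sum_const, Finset.card_univ, Fintype.card_fin, nsmul_eq_mul, ← mul_assoc]
        gcongr
        rw [← mul_div_assoc, div_le_iff₀ (by positivity)]
        nlinarith)
    have h0 : φ 0 = 0 := by simp [hφ']
    have h1 : φ 1 = f x - MvPolynomial.eval x
        (MvPolynomial.C (f 0) + ∑ i, MvPolynomial.X i * R i) := by simp [hφ]
    rw [h0, sub_zero, h1] at hmv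
    simpa using hmv


/-- smooth near the origin -/
def ESm {n : ℕ} {F : Type*} [NormedAddCommGroup F] [NormedSpace ℝ F] (f : (Fin n → ℝ) → F) : Prop :=
  ∀ᶠ x in 𝓝 (0 : Fin n → ℝ), ContDiffAt ℝ (⊤ : ℕ∞) f x

theorem esm_iff {n : ℕ} {F : Type*} [NormedAddCommGroup F] [NormedSpace ℝ F]
    (f : (Fin n → ℝ) → F) :
    (∃ U ∈ 𝓝 (0 : Fin n → ℝ), ContDiffOn ℝ (⊤ : ℕ∞) f U) ↔ ESm f := by
  constructor
  · rintro ⟨U, hU, hf⟩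
    filter_upwards [eventually_mem_nhds_iff.2 hU] with x hx
    exact hf.contDiffAt hx
  · intro h
    exact ⟨_, h, fun x hx => ContDiffAt.contDiffWithinAt hx⟩

theorem ESm.at {n : ℕ} {F : Type*} [NormedAddCommGroup F] [NormedSpace ℝ F]
    {f : (Fin n → ℝ) → F} (h : ESm f) : ContDiffAt ℝ (⊤ : ℕ∞) f 0 := h.self_of_nhds

theorem ESm.diff {n : ℕ} {F : Type*} [NormedAddCommGroup F] [NormedSpace ℝ F]
    {f : (Fin n → ℝ) → F} (h : ESm f) : DifferentiableAt ℝ f 0 :=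
  h.at.differentiableAt (by simp)

theorem ESm.comp {n : ℕ} {F : Type*} [NormedAddCommGroup F] [NormedSpace ℝ F]
    {f : (Fin n → ℝ) → F} {h : (Fin n → ℝ) → (Fin n → ℝ)} (hf : ESm f) (hh : ESm h)
    (h0 : h 0 = 0) : ESm (fun x => f (h x)) := by
  have ht : Tendsto h (𝓝 0) (𝓝 0) := by
    have := hh.diff.continuousAt.tendsto
    rwa [h0] at this
  filter_upwards [hh, ht.eventually hf] with x h1 h2
  exact ContDiffAt.comp x h2 h1

theorem contDiff_poly {n : ℕ} (P : MvPolynomial (Fin n) ℝ) :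
    ContDiff ℝ (⊤ : ℕ∞) fun x => MvPolynomial.eval x P := by
  rw [← contDiffOn_univ]
  exact (AnalyticOnNhd.eval_mvPolynomial P).contDiffOn uniqueDiffOn_univ

theorem contDiff_jet {k n p : ℕ} (z : JetSpace k n p) : ContDiff ℝ (⊤ : ℕ∞) z.eval :=
  contDiff_pi.2 fun j => contDiff_poly (z.1 j)

theorem esm_of_contDiff {n : ℕ} {F : Type*} [NormedAddCommGroup F] [NormedSpace ℝ F]
    {f : (Fin n → ℝ) → F} (h : ContDiff ℝ (⊤ : ℕ∞) f) : ESm f :=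
  Eventually.of_forall fun _ => h.contDiffAt

theorem jet_eval_zero {k n p : ℕ} (z : JetSpace k n p) : z.eval 0 = 0 := by
  funext j
  exact (eval_zero _).trans (coeff_jet_zero z j)

theorem mulVec_littleO {n p q : ℕ} {M : (Fin n → ℝ) → Matrix (Fin q) (Fin p) ℝ}
    (hM : ContinuousAt (fun x i j => M x i j) 0) {e : (Fin n → ℝ) → Fin p → ℝ}
    {g : (Fin n → ℝ) → ℝ} (he : e =o[𝓝 0] g) : (fun x => (M x).mulVec (e x)) =o[𝓝 0] g := by
  rw [isLittleO_pi]
  intro i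
  simp only [Matrix.mulVec, dotProduct]
  refine IsLittleO.fun_sum fun j _ => ?_
  have h1 : (fun x => M x i j) =O[𝓝 0] fun _ => (1 : ℝ) := by
    have : ContinuousAt (fun x => M x i j) 0 := continuousAt_pi.1 (continuousAt_pi.1 hM i) j
    exact this.tendsto.isBigO_one ℝ
  have h2 := h1.mul_isLittleO ((isLittleO_pi.1 he) j)
  simpa using h2

theorem comp_littleO {n k : ℕ} {F : Type*} [NormedAddCommGroup F] {e : (Fin n → ℝ) → F}
    {h : (Fin n → ℝ) → (Fin n → ℝ)} (he : e =o[𝓝 0] fun x => ‖x‖ ^ k) (h0 : h 0 = 0)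
    (hd : DifferentiableAt ℝ h 0) : (fun x => e (h x)) =o[𝓝 0] fun x => ‖x‖ ^ k := by
  have ht : Tendsto h (𝓝 0) (𝓝 0) := by
    have := hd.continuousAt.tendsto
    rwa [h0] at this
  have h1 := he.comp_tendsto ht
  refine h1.trans_isBigO ?_
  have h2 := hd.hasFDerivAt.isBigO_sub
  simp only [h0, sub_zero] at h2
  exact h2.norm_norm.pow k

/-- jet-level contact equivalence -/
def KE {k n p : ℕ} (z w : JetSpace k n p) : Prop :=
  ∃ (h : (Fin n → ℝ) → Fin n → ℝ) (M : (Fin n → ℝ) → Matrix (Fin p) (Fin p) ℝ),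
    h 0 = 0 ∧ ESm h ∧ Function.Bijective (fderiv ℝ h 0) ∧ ESm (fun x i j => M x i j) ∧
    IsUnit (M 0) ∧ IsJetAt w (fun x => (M x).mulVec (z.eval (h x)))

theorem esm_mulVec {n p : ℕ} {M : (Fin n → ℝ) → Matrix (Fin p) (Fin p) ℝ}
    (hM : ESm (fun x i j => M x i j)) {g : (Fin n → ℝ) → Fin p → ℝ} (hg : ESm g) :
    ESm (fun x => (M x).mulVec (g x)) := by
  filter_upwards [hM, hg] with x h1 h2
  rw [contDiffAt_pi]
  intro i
  simp only [Matrix.mulVec, dotProduct]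
  refine ContDiffAt.sum fun j _ => ?_
  exact (contDiffAt_pi.1 (contDiffAt_pi.1 h1 i) j).mul (contDiffAt_pi.1 h2 j)

theorem KE.kequiv {k n p : ℕ} {z w : JetSpace k n p} (H : KE z w) : KEquiv z w := by
  obtain ⟨h, M, h0, hh, hb, hM, hu, hj⟩ := H
  have hz := esm_of_contDiff (contDiff_jet z)
  refine ⟨z.eval, fun x => (M x).mulVec (z.eval (h x)), (esm_iff _).2 hz,
    (esm_iff _).2 (esm_mulVec hM (hz.comp hh h0)), jet_eval_zero z, ?_, ?_, hj,
    h, M, ⟨h0, (esm_iff _).2 hh, hb⟩, (esm_iff _).2 hM, hu, Eventually.of_forall fun x => rfl⟩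
  · simp [h0, jet_eval_zero]
  · simp only [IsJetAt, sub_self]
    exact isLittleO_zero _ _

theorem KE.of_kequiv {k n p : ℕ} {z w : JetSpace k n p} (H : KEquiv z w) : KE z w := by
  obtain ⟨f, g, hf, hg, hf0, hg0, hzf, hwg, h, M, ⟨h0, hh, hb⟩, hM, hu, he⟩ := H
  have hh' := (esm_iff _).1 hh
  have hM' := (esm_iff _).1 hM
  refine ⟨h, M, h0, hh', hb, hM', hu, ?_⟩
  have h1 := mulVec_littleO hM'.diff.continuousAt (comp_littleO hzf h0 hh'.diff)
  refine (hwg.sub h1).congr' ?_ EventuallyEq.rfl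
  filter_upwards [he] with x hx
  rw [hx, Matrix.mulVec_sub]
  abel

theorem KE.trans {k n p : ℕ} {z w v : JetSpace k n p} (H : KE z w) (H' : KE w v) : KE z v := by
  obtain ⟨h, M, h0, hh, hb, hM, hu, hj⟩ := H
  obtain ⟨h', M', h0', hh', hb', hM', hu', hj'⟩ := H'
  refine ⟨fun x => h (h' x), fun x => M' x * M (h' x), by simp [h0, h0'], hh.comp hh' h0', ?_, ?_,
    ?_, ?_⟩
  · have : fderiv ℝ (fun x => h (h' x)) 0 = (fderiv ℝ h 0).comp (fderiv ℝ h' 0) := by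
      have h1 : DifferentiableAt ℝ h (h' 0) := by rw [h0']; exact hh.diff
      have := fderiv_comp (𝕜 := ℝ) 0 h1 hh'.diff
      rw [h0'] at this
      exact this
    rw [this]
    exact hb.comp hb'
  · filter_upwards [hM', hM.comp hh' h0'] with x h1 h2
    rw [contDiffAt_pi]
    intro i
    rw [contDiffAt_pi]
    intro j
    simp only [Matrix.mul_apply]
    refine ContDiffAt.sum fun l _ => ?_
    exact (contDiffAt_pi.1 (contDiffAt_pi.1 h1 i) l).mul (contDiffAt_pi.1 (contDiffAt_pi.1 h2 l) j)
  · simp only [h0']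
    exact hu'.mul hu
  · have h1 := mulVec_littleO hM'.diff.continuousAt (comp_littleO hj h0' hh'.diff)
    refine (hj'.add h1).congr_left ?_
    intro x
    rw [Matrix.mulVec_sub, Matrix.mulVec_mulVec]
    abel

theorem omegaK_iff {k n p : ℕ} {hk : 1 ≤ k} {Ω : Set (JetSpace k n p)}
    {w : JetSpace k (n + 1) (p + 1)} :
    w ∈ OmegaK hk Ω 1 ↔ ∃ z ∈ Ω, KE (iPlusOne hk z) w :=
  ⟨fun ⟨z, hz, h⟩ => ⟨z, hz, KE.of_kequiv h⟩, fun ⟨z, hz, h⟩ => ⟨z, hz, h.kequiv⟩⟩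

/-- linear coefficients matrix of a polynomial self-map -/
noncomputable def linM {n m : ℕ} (h : Fin m → MvPolynomial (Fin n) ℝ) : Matrix (Fin m) (Fin n) ℝ :=
  Matrix.of fun i j => MvPolynomial.coeff (Finsupp.single j 1) (h i)

theorem hasFDerivAt_poly {n m : ℕ} (h : Fin m → MvPolynomial (Fin n) ℝ)
    (h0 : ∀ i, MvPolynomial.coeff 0 (h i) = 0) :
    HasFDerivAt (fun x i => MvPolynomial.eval x (h i))
      (LinearMap.toContinuousLinearMap (linM h).mulVecLin) 0 := by
  rw [hasFDerivAt_iff_isLittleO_nhds_zero, isLittleO_pi]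
  intro i
  have : (fun x => MvPolynomial.eval x (h i - ∑ j, MvPolynomial.C (linM h i j) * MvPolynomial.X j))
      =o[𝓝 (0 : Fin n → ℝ)] fun x => ‖x‖ ^ 1 := by
    apply poly_isLittleO
    intro d hd
    simp only [MvPolynomial.coeff_sub, MvPolynomial.coeff_sum, MvPolynomial.coeff_C_mul,
      MvPolynomial.coeff_X]
    rcases Nat.lt_or_ge 0 d.degree with h1 | h1
    · have hd1 : d.degree = 1 := by omega
      obtain ⟨l, rfl⟩ := (Finsupp.sum_eq_one_iff d).1 hd1
      simp [Finsupp.single_left_inj, linM]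
    · have : d = 0 := by
        rw [← Finsupp.degree_eq_zero_iff]; omega
      subst this
      simp [h0]
  simp only [pow_one] at this
  refine this.of_norm_right.congr_left fun x => ?_
  simp only [map_sub, map_sum, map_mul, MvPolynomial.eval_C, MvPolynomial.eval_X, zero_add,
    eval_zero, h0, Pi.sub_apply, sub_zero]
  rfl

theorem bij_of_det {n : ℕ} {h : (Fin n → ℝ) → Fin n → ℝ} {A : Matrix (Fin n) (Fin n) ℝ}
    (hA : A.det ≠ 0) (hd : HasFDerivAt h (LinearMap.toContinuousLinearMap A.mulVecLin) 0) :
    Function.Bijective (fderiv ℝ h 0) := by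
  rw [hd.fderiv]
  have hu : IsUnit A := (Matrix.isUnit_iff_isUnit_det A).2 (isUnit_iff_ne_zero.2 hA)
  exact ⟨Matrix.mulVec_injective_iff_isUnit.2 hu, Matrix.mulVec_surjective_iff_isUnit.2 hu⟩


/-- a family of polynomials with continuous coefficients -/
def CP {X : Type*} [TopologicalSpace X] (S : Set X) {n : ℕ}
    (Q : X → MvPolynomial (Fin n) ℝ) : Prop :=
  ∀ d, ContinuousOn (fun x => MvPolynomial.coeff d (Q x)) S

section
variable {X : Type*} [TopologicalSpace X] {S : Set X} {n : ℕ}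
  {P Q : X → MvPolynomial (Fin n) ℝ}

theorem CP.add (hP : CP S P) (hQ : CP S Q) : CP S (fun x => P x + Q x) := fun d => by
  simp only [MvPolynomial.coeff_add]
  exact (hP d).add (hQ d)

theorem CP.sub (hP : CP S P) (hQ : CP S Q) : CP S (fun x => P x - Q x) := fun d => by
  simp only [MvPolynomial.coeff_sub]
  exact (hP d).sub (hQ d)

theorem CP.mul (hP : CP S P) (hQ : CP S Q) : CP S (fun x => P x * Q x) := fun d => by
  classical
  simp only [MvPolynomial.coeff_mul]
  exact continuousOn_finsetSum _ fun a _ => (hP a.1).mul (hQ a.2)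

theorem CP.const (P : MvPolynomial (Fin n) ℝ) : CP S (fun _ => P) := fun _ => continuousOn_const

theorem CP.C {c : X → ℝ} (hc : ContinuousOn c S) :
    CP S (fun x => (MvPolynomial.C (c x) : MvPolynomial (Fin n) ℝ)) := fun d => by
  classical
  simp only [MvPolynomial.coeff_C]
  split_ifs
  · exact hc
  · exact continuousOn_const

theorem CP.pow (hP : CP S P) (m : ℕ) : CP S (fun x => P x ^ m) := by
  induction m with
  | zero => simpa using CP.const 1
  | succ m ih => simpa [pow_succ] using ih.mul hP

theorem CP.sum {ι : Type*} {s : Finset ι} {F : ι → X → MvPolynomial (Fin n) ℝ}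
    (h : ∀ i ∈ s, CP S (F i)) : CP S (fun x => ∑ i ∈ s, F i x) := fun d => by
  simp only [MvPolynomial.coeff_sum]
  exact continuousOn_finsetSum _ fun a ha => h a ha d

theorem CP.prod {ι : Type*} {s : Finset ι} {F : ι → X → MvPolynomial (Fin n) ℝ}
    (h : ∀ i ∈ s, CP S (F i)) : CP S (fun x => ∏ i ∈ s, F i x) := by
  classical
  induction s using Finset.induction_on with
  | empty => simpa using CP.const 1
  | insert a s ha ih =>
    simp only [Finset.prod_insert ha]
    exact (h a (Finset.mem_insert_self _ _)).mul
      (ih fun i hi => h i (Finset.mem_insert_of_mem hi))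

theorem CP.trunc (hP : CP S P) (k : ℕ) : CP S (fun x => truncPoly k (P x)) := fun d => by
  simp only [coeff_truncPoly]
  split_ifs
  · exact hP d
  · exact continuousOn_const

theorem continuousOn_jet_iff {k p : ℕ} {z : X → JetSpace k n p} :
    ContinuousOn z S ↔ ∀ j, CP S (fun x => (z x).1 j) := by
  have hind : Topology.IsInducing (jetCoeffs (k := k) (n := n) (p := p)) := ⟨rfl⟩
  rw [hind.continuousOn_iff, continuousOn_pi]
  refine forall_congr' fun j => ?_
  rw [continuousOn_pi]
  constructor
  · intro h d
    by_cases hd : ∀ i, d i < k + 1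
    · have := h fun i => ⟨d i, hd i⟩
      refine this.congr fun x _ => ?_
      simp only [Function.comp, jetCoeffs]
      congr 1
      ext i; simp
    · push Not at hd
      obtain ⟨i, hi⟩ := hd
      have : ∀ x, MvPolynomial.coeff d ((z x).1 j) = 0 := fun x => by
        apply coeff_jet_big
        have := Finsupp.le_degree i d
        omega
      simp only [this]
      exact continuousOn_const
  · intro h e
    exact h _
end

theorem jet_expand {k n p : ℕ} (z : JetSpace k n p) (j : Fin p) :
    z.1 j = ∑ e : Fin n → Fin (k + 1),
      MvPolynomial.monomial (Finsupp.equivFunOnFinite.symm fun i => (e i : ℕ)) (jetCoeffs z j e) := by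
  classical
  ext d
  rw [MvPolynomial.coeff_sum]
  simp only [MvPolynomial.coeff_monomial, jetCoeffs]
  by_cases hd : ∀ i, d i < k + 1
  · have hE : ∀ e : Fin n → Fin (k + 1),
        (Finsupp.equivFunOnFinite.symm fun i => (e i : ℕ)) = d ↔ e = fun i => ⟨d i, hd i⟩ := by
      intro e
      constructor
      · intro h
        funext i
        apply Fin.ext
        simp [← h]
      · rintro rfl
        ext i; simp
    simp only [hE, Finset.sum_ite_eq', Finset.mem_univ, if_true]
    congr 1
    ext i; simp
  · push Not at hd
    obtain ⟨i, hi⟩ := hd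
    rw [coeff_jet_big z j d (by have := Finsupp.le_degree i d; omega)]
    symm
    refine Finset.sum_eq_zero fun e _ => ?_
    rw [if_neg]
    intro h
    have h1 : d i = e i := by rw [← h]; simp
    have := (e i).2
    omega

theorem CP.aeval {X : Type*} [TopologicalSpace X] {S : Set X} {k n p m : ℕ}
    {z : X → JetSpace k n p} (hz : ContinuousOn z S) (j : Fin p)
    {h : X → Fin n → MvPolynomial (Fin m) ℝ} (hh : ∀ i, CP S (fun x => h x i)) :
    CP S (fun x => MvPolynomial.aeval (h x) ((z x).1 j)) := by
  have : ∀ x, MvPolynomial.aeval (h x) ((z x).1 j) = ∑ e : Fin n → Fin (k + 1),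
      MvPolynomial.C (jetCoeffs (z x) j e) * ∏ i, h x i ^ (e i : ℕ) := by
    intro x
    rw [jet_expand (z x) j, map_sum]
    refine Finset.sum_congr rfl fun e _ => ?_
    rw [MvPolynomial.aeval_monomial, Finsupp.prod_fintype _ _ (by simp),
      MvPolynomial.algebraMap_eq]
    simp
  simp only [this]
  refine CP.sum fun e _ => CP.mul (CP.C ?_) (CP.prod fun i _ => (hh i).pow _)
  exact continuousOn_jet_iff.1 hz j _

/-- action of polynomial data on jets -/
noncomputable def act {k n p : ℕ} (h : Fin n → MvPolynomial (Fin n) ℝ)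
    (M : Fin p → Fin p → MvPolynomial (Fin n) ℝ) (w : JetSpace k n p) : JetSpace k n p :=
  truncJet k n p fun j => ∑ i, M j i * MvPolynomial.aeval h (w.1 i)

theorem act_continuousOn {X : Type*} [TopologicalSpace X] {S : Set X} {k n p : ℕ}
    {z : X → JetSpace k n p} (hz : ContinuousOn z S)
    {h : X → Fin n → MvPolynomial (Fin n) ℝ} (hh : ∀ i, CP S (fun x => h x i))
    {M : X → Fin p → Fin p → MvPolynomial (Fin n) ℝ} (hM : ∀ i j, CP S (fun x => M x i j)) :
    ContinuousOn (fun x => act (h x) (M x) (z x)) S := by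
  rw [continuousOn_jet_iff]
  intro j
  refine CP.trunc (CP.sum fun i _ => (hM j i).mul ?_) k
  exact CP.aeval hz i hh

theorem coeff_zero_mul' {n : ℕ} (P Q : MvPolynomial (Fin n) ℝ) :
    MvPolynomial.coeff 0 (P * Q) = MvPolynomial.coeff 0 P * MvPolynomial.coeff 0 Q :=
  map_mul MvPolynomial.constantCoeff P Q

theorem coeff_zero_aeval {n m : ℕ} {h : Fin n → MvPolynomial (Fin m) ℝ}
    (h0 : ∀ i, MvPolynomial.coeff 0 (h i) = 0) (P : MvPolynomial (Fin n) ℝ) :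
    MvPolynomial.coeff 0 (MvPolynomial.aeval h P) = MvPolynomial.coeff 0 P := by
  classical
  induction P using MvPolynomial.induction_on with
  | C a => rw [MvPolynomial.aeval_C, MvPolynomial.algebraMap_eq, MvPolynomial.coeff_C, MvPolynomial.coeff_C, if_pos rfl, if_pos rfl]
  | add p q hp hq => rw [map_add, MvPolynomial.coeff_add, MvPolynomial.coeff_add, hp, hq]
  | mul_X p i hp => rw [map_mul, coeff_zero_mul', coeff_zero_mul', MvPolynomial.aeval_X, h0, MvPolynomial.coeff_zero_X, mul_zero, mul_zero]

theorem coeff_single_mul {n : ℕ} (P Q : MvPolynomial (Fin n) ℝ) (i : Fin n) :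
    MvPolynomial.coeff (Finsupp.single i 1) (P * Q) =
      MvPolynomial.coeff 0 P * MvPolynomial.coeff (Finsupp.single i 1) Q +
      MvPolynomial.coeff (Finsupp.single i 1) P * MvPolynomial.coeff 0 Q := by
  classical
  rw [MvPolynomial.coeff_mul, Finsupp.antidiagonal_single, Finset.sum_map]
  simp [Finset.Nat.antidiagonal_succ]

theorem coeff_single_aeval {n m : ℕ} {h : Fin n → MvPolynomial (Fin m) ℝ}
    (h0 : ∀ i, MvPolynomial.coeff 0 (h i) = 0) (P : MvPolynomial (Fin n) ℝ) (i : Fin m) :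
    MvPolynomial.coeff (Finsupp.single i 1) (MvPolynomial.aeval h P) =
      ∑ l, MvPolynomial.coeff (Finsupp.single l 1) P *
        MvPolynomial.coeff (Finsupp.single i 1) (h l) := by
  classical
  induction P using MvPolynomial.induction_on with
  | C a =>
    have hne : ∀ {m : ℕ} (i : Fin m), (0 : Fin m →₀ ℕ) ≠ Finsupp.single i 1 := by
      intro m i h
      have := DFunLike.congr_fun h i
      simp at this
    rw [MvPolynomial.aeval_C, MvPolynomial.algebraMap_eq, MvPolynomial.coeff_C, if_neg (hne i)]
    symm
    refine Finset.sum_eq_zero fun l _ => ?_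
    rw [MvPolynomial.coeff_C, if_neg (hne l), zero_mul]
  | add p q hp hq =>
    simp only [map_add, MvPolynomial.coeff_add, hp, hq, add_mul, Finset.sum_add_distrib]
  | mul_X p j hp =>
    rw [map_mul, coeff_single_mul, hp, MvPolynomial.aeval_X, h0, mul_zero, add_zero,
      coeff_zero_aeval h0]
    simp only [coeff_single_mul, MvPolynomial.coeff_X, MvPolynomial.coeff_zero_X, mul_zero,
      add_zero]
    simp [Finsupp.single_left_inj]

theorem eval_aeval {n m : ℕ} (h : Fin n → MvPolynomial (Fin m) ℝ) (P : MvPolynomial (Fin n) ℝ)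
    (x : Fin m → ℝ) : MvPolynomial.eval x (MvPolynomial.aeval h P) =
      MvPolynomial.eval (fun i => MvPolynomial.eval x (h i)) P := by
  induction P using MvPolynomial.induction_on with
  | C a => simp [MvPolynomial.algebraMap_eq]
  | add p q hp hq => simp only [map_add, hp, hq]
  | mul_X p i hp => simp only [map_mul, hp, MvPolynomial.aeval_X, MvPolynomial.eval_X]

theorem coeff_zero_act {k n p : ℕ} {h : Fin n → MvPolynomial (Fin n) ℝ}
    (M : Fin p → Fin p → MvPolynomial (Fin n) ℝ) (w : JetSpace k n p)
    (h0 : ∀ i, MvPolynomial.coeff 0 (h i) = 0) (j : Fin p) :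
    MvPolynomial.coeff 0 (∑ i, M j i * MvPolynomial.aeval h (w.1 i)) = 0 := by
  rw [MvPolynomial.coeff_sum]
  refine Finset.sum_eq_zero fun i _ => ?_
  rw [coeff_zero_mul', coeff_zero_aeval h0, coeff_jet_zero, mul_zero]

theorem act_isJetAt {k n p : ℕ} {h : Fin n → MvPolynomial (Fin n) ℝ}
    (M : Fin p → Fin p → MvPolynomial (Fin n) ℝ) (w : JetSpace k n p)
    (h0 : ∀ i, MvPolynomial.coeff 0 (h i) = 0) :
    IsJetAt (act h M w) fun x => (Matrix.of fun j i => MvPolynomial.eval x (M j i)).mulVec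
      (w.eval fun i => MvPolynomial.eval x (h i)) := by
  refine isJetAt_truncJet (coeff_zero_act M w h0) fun j => ?_
  refine (isLittleO_zero _ _).congr_left fun x => ?_
  simp only [Matrix.mulVec, dotProduct, JetSpace.eval, map_sum, map_mul, eval_aeval,
    Matrix.of_apply, sub_self]

theorem esm_polyMat {n p : ℕ} (M : Fin p → Fin p → MvPolynomial (Fin n) ℝ) :
    ESm fun x i j => (Matrix.of fun j i => MvPolynomial.eval x (M j i)) i j :=
  esm_of_contDiff (contDiff_pi.2 fun i => contDiff_pi.2 fun j => contDiff_poly (M i j))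

theorem polyMat_zero {n p : ℕ} {M : Fin p → Fin p → MvPolynomial (Fin n) ℝ}
    (hM : (Matrix.of fun j i => MvPolynomial.coeff 0 (M j i)).det ≠ 0) :
    IsUnit (Matrix.of fun j i => MvPolynomial.eval (0 : Fin n → ℝ) (M j i)) := by
  simp only [eval_zero]
  exact (Matrix.isUnit_iff_isUnit_det _).2 (isUnit_iff_ne_zero.2 hM)

theorem KE.poly {k n p : ℕ} {h : Fin n → MvPolynomial (Fin n) ℝ}
    {M : Fin p → Fin p → MvPolynomial (Fin n) ℝ} {z w : JetSpace k n p}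
    (h0 : ∀ i, MvPolynomial.coeff 0 (h i) = 0) (hdet : (linM h).det ≠ 0)
    (hM : (Matrix.of fun j i => MvPolynomial.coeff 0 (M j i)).det ≠ 0)
    (hj : IsJetAt w fun x => (Matrix.of fun j i => MvPolynomial.eval x (M j i)).mulVec
      (z.eval fun i => MvPolynomial.eval x (h i))) : KE z w := by
  refine ⟨_, _, ?_, ?_, bij_of_det hdet (hasFDerivAt_poly h h0), esm_polyMat M, polyMat_zero hM, hj⟩
  · funext i
    rw [eval_zero, h0]; rfl
  · exact esm_of_contDiff (contDiff_pi.2 fun i => contDiff_poly (h i))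

theorem KE.act {k n p : ℕ} {h : Fin n → MvPolynomial (Fin n) ℝ}
    {M : Fin p → Fin p → MvPolynomial (Fin n) ℝ} (w : JetSpace k n p)
    (h0 : ∀ i, MvPolynomial.coeff 0 (h i) = 0) (hdet : (linM h).det ≠ 0)
    (hM : (Matrix.of fun j i => MvPolynomial.coeff 0 (M j i)).det ≠ 0) :
    KE w (act h M w) := KE.poly h0 hdet hM (act_isJetAt M w h0)


open MvPolynomial in
/-- substitute `s` for the last variable -/
noncomputable def sbs {n : ℕ} (s : MvPolynomial (Fin n) ℝ) (P : MvPolynomial (Fin (n+1)) ℝ) :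
    MvPolynomial (Fin n) ℝ :=
  aeval (Fin.snoc (α := fun _ => MvPolynomial (Fin n) ℝ) X s : Fin (n+1) → MvPolynomial (Fin n) ℝ) P

open MvPolynomial in
theorem sbs_rename {n : ℕ} (s A : MvPolynomial (Fin n) ℝ) : sbs s (rename Fin.castSucc A) = A := by
  rw [sbs, aeval_rename]
  have : (Fin.snoc (α := fun _ => MvPolynomial (Fin n) ℝ) X s : Fin (n+1) → MvPolynomial (Fin n) ℝ)
      ∘ Fin.castSucc = X := by
    funext i
    simp
  rw [this, aeval_X_left]; rfl

open MvPolynomial in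
theorem sbs_last {n : ℕ} (s : MvPolynomial (Fin n) ℝ) : sbs s (X (Fin.last n)) = s := by
  rw [sbs, aeval_X, Fin.snoc_last]

open MvPolynomial in
theorem sbs_X {n : ℕ} (s : MvPolynomial (Fin n) ℝ) (i : Fin n) : sbs s (X i.castSucc) = X i := by
  rw [sbs, aeval_X, Fin.snoc_castSucc]

theorem sbs_mul {n : ℕ} (s : MvPolynomial (Fin n) ℝ) (P Q : MvPolynomial (Fin (n+1)) ℝ) :
    sbs s (P * Q) = sbs s P * sbs s Q := map_mul _ _ _
theorem sbs_add {n : ℕ} (s : MvPolynomial (Fin n) ℝ) (P Q : MvPolynomial (Fin (n+1)) ℝ) :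
    sbs s (P + Q) = sbs s P + sbs s Q := map_add _ _ _
theorem sbs_sub {n : ℕ} (s : MvPolynomial (Fin n) ℝ) (P Q : MvPolynomial (Fin (n+1)) ℝ) :
    sbs s (P - Q) = sbs s P - sbs s Q := map_sub _ _ _

open MvPolynomial in
theorem hadamard {n : ℕ} (s : MvPolynomial (Fin n) ℝ) (P : MvPolynomial (Fin (n+1)) ℝ) :
    ∃ q, P = rename Fin.castSucc (sbs s P) + (X (Fin.last n) - rename Fin.castSucc s) * q := by
  induction P using MvPolynomial.induction_on with
  | C a =>
    refine ⟨0, ?_⟩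
    rw [sbs, aeval_C, algebraMap_eq, rename_C, mul_zero, add_zero]
  | add p q hp hq =>
    obtain ⟨a, ha⟩ := hp
    obtain ⟨b, hb⟩ := hq
    refine ⟨a + b, ?_⟩
    rw [sbs_add, map_add]
    linear_combination ha + hb
  | mul_X p i hp =>
    obtain ⟨a, ha⟩ := hp
    have : ∃ b, (X i : MvPolynomial (Fin (n+1)) ℝ) = rename Fin.castSucc (sbs s (X i)) +
        (X (Fin.last n) - rename Fin.castSucc s) * b := by
      refine Fin.lastCases ?_ (fun i => ?_) i
      · refine ⟨1, ?_⟩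
        rw [sbs_last]; ring
      · refine ⟨0, ?_⟩
        rw [sbs_X, rename_X]; ring
    obtain ⟨b, hb⟩ := this
    refine ⟨a * rename Fin.castSucc (sbs s (X i)) + p * b, ?_⟩
    rw [sbs_mul, map_mul]
    linear_combination rename Fin.castSucc (sbs s (X i)) * ha + p * hb

open MvPolynomial in
theorem coeff_last_rename {n : ℕ} (A : MvPolynomial (Fin n) ℝ) :
    coeff (Finsupp.single (Fin.last n) 1) (rename Fin.castSucc A) = 0 := by
  apply coeff_rename_eq_zero
  intro u hu
  exfalso
  have := DFunLike.congr_fun hu (Fin.last n)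
  rw [Finsupp.mapDomain_notin_range _ _ (by
    rintro ⟨i, hi⟩
    exact (Fin.castSucc_lt_last i).ne hi)] at this
  simp at this

open MvPolynomial in
theorem coeff_castSucc_rename {n : ℕ} (A : MvPolynomial (Fin n) ℝ) (i : Fin n) :
    coeff (Finsupp.single i.castSucc 1) (rename Fin.castSucc A) = coeff (Finsupp.single i 1) A := by
  rw [← coeff_rename_mapDomain _ (Fin.castSucc_injective n), Finsupp.mapDomain_single]

open MvPolynomial in
theorem coeff_zero_rename {n : ℕ} (A : MvPolynomial (Fin n) ℝ) :
    coeff 0 (rename (Fin.castSucc) A) = coeff 0 A := by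
  rw [← constantCoeff_eq, ← constantCoeff_eq, constantCoeff_rename]

def Ord {n : ℕ} (m : ℕ) (P : MvPolynomial (Fin n) ℝ) : Prop :=
  ∀ d : Fin n →₀ ℕ, d.degree ≤ m → MvPolynomial.coeff d P = 0

theorem Ord.mul {n m : ℕ} {P F : MvPolynomial (Fin n) ℝ} (hP : Ord m P)
    (hF : MvPolynomial.coeff 0 F = 0) : Ord (m+1) (P * F) := by
  classical
  intro d hd
  rw [MvPolynomial.coeff_mul]
  refine Finset.sum_eq_zero fun ab hab => ?_
  rw [Finset.HasAntidiagonal.mem_antidiagonal] at hab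
  by_cases hb : ab.2 = 0
  · rw [hb, hF, mul_zero]
  · have h1 : ab.2.degree ≠ 0 := fun h => hb ((Finsupp.degree_eq_zero_iff _).1 h)
    have h2 : ab.1.degree + ab.2.degree = d.degree := by rw [← hab, map_add]
    rw [hP _ (by omega), zero_mul]

theorem Ord.rename {n m : ℕ} {P : MvPolynomial (Fin n) ℝ} (hP : Ord m P) :
    Ord m (MvPolynomial.rename Fin.castSucc P) := by
  intro d hd
  by_contra hne
  obtain ⟨u, hu, hc⟩ := MvPolynomial.coeff_rename_ne_zero _ _ _ hne
  refine hc (hP u ?_)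
  rw [← hu, Finsupp.degree_mapDomain] at hd
  exact hd

open MvPolynomial in
theorem snoc_zero {n : ℕ} {s : MvPolynomial (Fin n) ℝ} (hs : coeff 0 s = 0) (i : Fin (n+1)) :
    coeff 0 ((Fin.snoc (α := fun _ => MvPolynomial (Fin n) ℝ) X s : Fin (n+1) → MvPolynomial (Fin n) ℝ) i) = 0 := by
  refine Fin.lastCases ?_ (fun i => ?_) i
  · rwa [Fin.snoc_last]
  · rw [Fin.snoc_castSucc, coeff_zero_X]

theorem coeff_zero_sbs {n : ℕ} {s : MvPolynomial (Fin n) ℝ} (hs : MvPolynomial.coeff 0 s = 0)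
    (P : MvPolynomial (Fin (n+1)) ℝ) :
    MvPolynomial.coeff 0 (sbs s P) = MvPolynomial.coeff 0 P := coeff_zero_aeval (snoc_zero hs) P

open MvPolynomial in
theorem hadamard_coeff {n : ℕ} {s A : MvPolynomial (Fin n) ℝ} (hs : coeff 0 s = 0)
    {P q : MvPolynomial (Fin (n+1)) ℝ}
    (h : P = rename Fin.castSucc A + (X (Fin.last n) - rename Fin.castSucc s) * q) :
    coeff 0 q = coeff (Finsupp.single (Fin.last n) 1) P := by
  rw [h, coeff_add, coeff_single_mul, coeff_sub, coeff_sub, coeff_last_rename, coeff_last_rename,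
    coeff_zero_rename, hs, coeff_zero_X]
  simp [coeff_X]

open MvPolynomial in
noncomputable def newton {n : ℕ} (c : ℝ) (g : MvPolynomial (Fin (n+1)) ℝ) :
    ℕ → MvPolynomial (Fin n) ℝ
  | 0 => 0
  | m + 1 => newton c g m - C c⁻¹ * sbs (newton c g m) g

open MvPolynomial in
theorem newton_coeff {n : ℕ} {c : ℝ} {g : MvPolynomial (Fin (n+1)) ℝ} (hg : coeff 0 g = 0) (m : ℕ) :
    coeff 0 (newton c g m) = 0 := by
  induction m with
  | zero => simp [newton]
  | succ m ih => rw [newton, coeff_sub, coeff_C_mul, coeff_zero_sbs ih, ih, hg]; simp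

open MvPolynomial in
theorem newton_ord {n : ℕ} {g : MvPolynomial (Fin (n+1)) ℝ} (hg : coeff 0 g = 0)
    {c : ℝ} (hc : coeff (Finsupp.single (Fin.last n) 1) g = c) (hc0 : c ≠ 0) (m : ℕ) :
    Ord m (sbs (newton c g m) g) := by
  induction m with
  | zero =>
    intro d hd
    have : d = 0 := (Finsupp.degree_eq_zero_iff d).1 (by omega)
    rw [this, coeff_zero_sbs (newton_coeff hg 0), hg]
  | succ m ih =>
    set s := newton c g m with hs
    have hs0 : coeff 0 s = 0 := newton_coeff hg m
    have hs1 : coeff 0 (newton c g (m+1)) = 0 := newton_coeff hg (m+1)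
    obtain ⟨q, hq⟩ := hadamard s g
    have hq0 := hadamard_coeff hs0 hq
    have key : sbs (newton c g (m+1)) g =
        sbs s g * (1 - C c⁻¹ * sbs (newton c g (m+1)) q) := by
      have hs' : newton c g (m+1) = s - C c⁻¹ * sbs s g := rfl
      generalize newton c g (m+1) = s' at hs'
      have h2 := congrArg (sbs s') hq
      rw [sbs_add, sbs_mul, sbs_sub, sbs_rename, sbs_rename, sbs_last] at h2
      linear_combination h2 + sbs s' q * hs'
    rw [key]
    refine ih.mul ?_
    rw [coeff_sub, coeff_C_mul, coeff_zero_sbs hs1, hq0, hc, inv_mul_cancel₀ hc0]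
    simp

/-- coefficient of the last variable in the last component -/
noncomputable def lastc {k n p : ℕ} (v : JetSpace k (n+1) (p+1)) : ℝ :=
  MvPolynomial.coeff (Finsupp.single (Fin.last n) 1) (v.1 (Fin.last p))

noncomputable def nu {k n p : ℕ} (v : JetSpace k (n+1) (p+1)) : MvPolynomial (Fin n) ℝ :=
  newton (lastc v) (v.1 (Fin.last p)) k

noncomputable def rho {k n p : ℕ} (v : JetSpace k (n+1) (p+1)) : JetSpace k n p :=
  truncJet k n p fun j => sbs (nu v) (v.1 j.castSucc)

theorem rho_continuousOn {k n p : ℕ} :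
    ContinuousOn (rho (k := k) (n := n) (p := p)) {v | lastc v ≠ 0} := by
  have hid : ContinuousOn (fun v : JetSpace k (n+1) (p+1) => v) {v | lastc v ≠ 0} := continuousOn_id
  have hs : ∀ s : JetSpace k (n+1) (p+1) → MvPolynomial (Fin n) ℝ, CP {v | lastc v ≠ 0} s →
      ∀ j, CP {v | lastc v ≠ 0} fun v => sbs (s v) (v.1 j) := by
    intro s hs j
    refine CP.aeval hid j fun i => ?_
    refine Fin.lastCases ?_ (fun i => ?_) i
    · simpa using hs
    · simpa using CP.const _
  have hc : ContinuousOn (fun v : JetSpace k (n+1) (p+1) => (lastc v)⁻¹) {v | lastc v ≠ 0} := by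
    refine ContinuousOn.inv₀ ?_ fun v hv => hv
    exact continuousOn_jet_iff.1 hid _ _
  have hn : ∀ m, CP {v : JetSpace k (n+1) (p+1) | lastc v ≠ 0}
      fun v => newton (lastc v) (v.1 (Fin.last p)) m := by
    intro m
    induction m with
    | zero => exact CP.const 0
    | succ m ih => exact ih.sub ((CP.C hc).mul (hs _ ih _))
  rw [continuousOn_jet_iff]
  intro j
  exact (hs _ (hn k) j.castSucc).trunc k

theorem iPlusOne_last {k n p : ℕ} (hk : 1 ≤ k) (z : JetSpace k n p) :
    (iPlusOne hk z).1 (Fin.last p) = MvPolynomial.X (Fin.last n) := by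
  simp only [iPlusOne, Fin.snoc_last]

theorem iPlusOne_castSucc {k n p : ℕ} (hk : 1 ≤ k) (z : JetSpace k n p) (j : Fin p) :
    (iPlusOne hk z).1 j.castSucc = MvPolynomial.rename Fin.castSucc (z.1 j) := by
  simp only [iPlusOne, Fin.snoc_castSucc]

theorem lastc_iPlusOne {k n p : ℕ} (hk : 1 ≤ k) (z : JetSpace k n p) :
    lastc (iPlusOne hk z) = 1 := by
  rw [lastc, iPlusOne_last]; simp [MvPolynomial.coeff_X]

theorem rho_iPlusOne {k n p : ℕ} (hk : 1 ≤ k) (z : JetSpace k n p) :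
    rho (iPlusOne hk z) = z := by
  have h : ∀ s : MvPolynomial (Fin n) ℝ, (fun j : Fin p => sbs s ((iPlusOne hk z).1 j.castSucc)) = z.1 := by
    intro s
    funext j
    rw [iPlusOne_castSucc, sbs_rename]
  rw [rho, h, truncJet_self]

theorem truncJet_eq {k n p : ℕ} (v : JetSpace k n p) (Q : Fin p → MvPolynomial (Fin n) ℝ)
    (h : ∀ j, Ord k (v.1 j - Q j)) : truncJet k n p Q = v := by
  rw [← truncJet_self v]
  apply Subtype.ext
  funext j
  ext d
  simp only [truncJet, coeff_truncPoly]
  split_ifs with hd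
  · have := h j d hd.2
    rw [MvPolynomial.coeff_sub] at this
    linarith
  · rfl

theorem KE_rho {k n p : ℕ} (hk : 1 ≤ k) (v : JetSpace k (n+1) (p+1)) (hv : lastc v ≠ 0) :
    KE (iPlusOne hk (rho v)) v := by
  have hg0 := coeff_jet_zero v (Fin.last p)
  set s := nu v with hs
  have hs0 : MvPolynomial.coeff 0 s = 0 := newton_coeff hg0 k
  have hord : Ord k (sbs s (v.1 (Fin.last p))) := newton_ord hg0 rfl hv k
  choose q hq using fun j => hadamard s (v.1 j)
  have hq0 : MvPolynomial.coeff 0 (q (Fin.last p)) = lastc v := hadamard_coeff hs0 (hq (Fin.last p))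
  let H : Fin (n+1) → MvPolynomial (Fin (n+1)) ℝ :=
    Fin.snoc (α := fun _ => MvPolynomial (Fin (n+1)) ℝ) (fun i => MvPolynomial.X i.castSucc)
      (MvPolynomial.X (Fin.last n) - MvPolynomial.rename Fin.castSucc s)
  let M : Fin (p+1) → Fin (p+1) → MvPolynomial (Fin (n+1)) ℝ := fun j i =>
    if i = Fin.last p then q j else if i = j then 1 else 0
  have hH0 : ∀ i, MvPolynomial.coeff 0 (H i) = 0 := by
    intro i
    refine Fin.lastCases ?_ (fun i => ?_) i
    · simp only [H, Fin.snoc_last, MvPolynomial.coeff_sub, MvPolynomial.coeff_zero_X,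
        coeff_zero_rename, hs0, sub_zero]
    · simp only [H, Fin.snoc_castSucc, MvPolynomial.coeff_zero_X]
  have hdetH : (linM H).det ≠ 0 := by
    rw [Matrix.det_of_lowerTriangular]
    · refine Finset.prod_ne_zero_iff.2 fun i _ => ?_
      refine Fin.lastCases ?_ (fun i => ?_) i
      · simp only [linM, Matrix.of_apply, H, Fin.snoc_last, MvPolynomial.coeff_sub,
          coeff_last_rename]
        simp [MvPolynomial.coeff_X]
      · simp [linM, Matrix.of_apply, H, Fin.snoc_castSucc, MvPolynomial.coeff_X]
    · intro i j hij
      have hij : i < j := hij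
      revert hij
      refine Fin.lastCases ?_ (fun i => ?_) i
      · intro hij; exact absurd hij (not_lt.2 (Fin.le_last j))
      · intro hij
        simp only [linM, Matrix.of_apply, H, Fin.snoc_castSucc, MvPolynomial.coeff_X,
          Finsupp.single_left_inj one_ne_zero]
        rw [if_neg hij.ne]
  have hdetM : (Matrix.of fun j i => MvPolynomial.coeff 0 (M j i)).det ≠ 0 := by
    rw [Matrix.det_of_upperTriangular]
    · refine Finset.prod_ne_zero_iff.2 fun i _ => ?_
      by_cases hi : i = Fin.last p
      · subst hi
        simp only [Matrix.of_apply, M, if_true]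
        rwa [hq0]
      · simp [M, hi]
    · intro i j hij
      have hij : j < i := hij
      have h1 : j ≠ Fin.last p := (lt_of_lt_of_le hij (Fin.le_last i)).ne
      simp only [Matrix.of_apply, M, if_neg h1, if_neg hij.ne, MvPolynomial.coeff_zero]
  have hact : act H M (iPlusOne hk (rho v)) = v := by
    apply truncJet_eq
    have hr : ∀ j : Fin p, MvPolynomial.aeval H ((iPlusOne hk (rho v)).1 j.castSucc) =
        MvPolynomial.rename Fin.castSucc (truncPoly k (sbs s (v.1 j.castSucc))) := by
      intro j
      rw [iPlusOne_castSucc, MvPolynomial.aeval_rename]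
      have : H ∘ Fin.castSucc = fun i => MvPolynomial.X i.castSucc := by
        funext i; simp only [H, Function.comp, Fin.snoc_castSucc]
      rw [this, MvPolynomial.rename_eq_aeval]
      rfl
    have hl : MvPolynomial.aeval H ((iPlusOne hk (rho v)).1 (Fin.last p)) =
        MvPolynomial.X (Fin.last n) - MvPolynomial.rename Fin.castSucc s := by
      rw [iPlusOne_last, MvPolynomial.aeval_X]
      simp only [H, Fin.snoc_last]
    intro j
    rw [Fin.sum_univ_castSucc, hl]
    simp only [hr]
    refine Fin.lastCases ?_ (fun j => ?_) j
    · have : v.1 (Fin.last p) - (∑ i : Fin p, M (Fin.last p) i.castSucc *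
          MvPolynomial.rename Fin.castSucc (truncPoly k (sbs s (v.1 i.castSucc))) +
          M (Fin.last p) (Fin.last p) *
          (MvPolynomial.X (Fin.last n) - MvPolynomial.rename Fin.castSucc s)) =
          MvPolynomial.rename Fin.castSucc (sbs s (v.1 (Fin.last p))) := by
        rw [Finset.sum_eq_zero]
        · simp only [M, if_true]
          linear_combination hq (Fin.last p)
        · intro i _
          simp [M, (Fin.castSucc_lt_last i).ne]
      rw [this]
      exact hord.rename
    · have : v.1 j.castSucc - (∑ i : Fin p, M j.castSucc i.castSucc *
          MvPolynomial.rename Fin.castSucc (truncPoly k (sbs s (v.1 i.castSucc))) +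
          M j.castSucc (Fin.last p) *
          (MvPolynomial.X (Fin.last n) - MvPolynomial.rename Fin.castSucc s)) =
          MvPolynomial.rename Fin.castSucc (sbs s (v.1 j.castSucc) -
            truncPoly k (sbs s (v.1 j.castSucc))) := by
        rw [Finset.sum_eq_single j]
        · simp only [M, if_true, if_neg (Fin.castSucc_lt_last j).ne, map_sub]
          linear_combination hq j.castSucc
        · intro i _ hij
          simp [M, (Fin.castSucc_lt_last i).ne, hij]
        · intro h; exact absurd (Finset.mem_univ j) h
      rw [this]
      refine Ord.rename fun d hd => ?_
      rw [MvPolynomial.coeff_sub, coeff_truncPoly]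
      split_ifs with h1
      · simp
      · have : d = 0 := (Finsupp.degree_eq_zero_iff d).1 (by omega)
        rw [this, coeff_zero_sbs hs0, coeff_jet_zero, sub_zero]
  have := KE.act (iPlusOne hk (rho v)) hH0 hdetH hdetM
  rwa [hact] at this


theorem lo_at_zero {k n : ℕ} {F : Type*} [NormedAddCommGroup F] {f : (Fin n → ℝ) → F}
    (h : f =o[𝓝 0] fun x => ‖x‖ ^ k) (hk : 1 ≤ k) : f 0 = 0 := by
  have := (h.bound (c := 1) one_pos).self_of_nhds
  simp only [norm_zero, zero_pow (by omega : k ≠ 0), mul_zero] at this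
  exact norm_le_zero_iff.1 this

theorem det_cd {n p : ℕ} {A : (Fin n → ℝ) → Matrix (Fin p) (Fin p) ℝ} {x : Fin n → ℝ}
    (hA : ∀ i j, ContDiffAt ℝ (⊤ : ℕ∞) (fun x => A x i j) x) :
    ContDiffAt ℝ (⊤ : ℕ∞) (fun x => (A x).det) x := by
  simp only [Matrix.det_apply, zsmul_eq_mul, Units.smul_def]
  refine ContDiffAt.sum fun τ _ => contDiffAt_const.mul ?_
  exact contDiffAt_prod fun i _ => hA _ _

theorem inv_cd {n p : ℕ} {A : (Fin n → ℝ) → Matrix (Fin p) (Fin p) ℝ} {x : Fin n → ℝ}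
    (hA : ∀ i j, ContDiffAt ℝ (⊤ : ℕ∞) (fun x => A x i j) x) (h0 : (A x).det ≠ 0) (i j : Fin p) :
    ContDiffAt ℝ (⊤ : ℕ∞) (fun x => (A x)⁻¹ i j) x := by
  simp only [Matrix.inv_def, Ring.inverse_eq_inv', Matrix.smul_apply, smul_eq_mul,
    Matrix.adjugate_apply]
  refine ((det_cd hA).inv h0).mul (det_cd fun a b => ?_)
  simp only [Matrix.updateRow_apply]
  split_ifs
  · exact contDiffAt_const
  · exact hA a b

theorem act_jet_approx {k n p : ℕ} (w : JetSpace k n p)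
    {η : (Fin n → ℝ) → Fin n → ℝ} {N : (Fin n → ℝ) → Matrix (Fin p) (Fin p) ℝ}
    {hp : Fin n → MvPolynomial (Fin n) ℝ} {Np : Fin p → Fin p → MvPolynomial (Fin n) ℝ}
    (h0 : ∀ i, MvPolynomial.coeff 0 (hp i) = 0) (hη0 : η 0 = 0) (hηc : ContinuousAt η 0)
    (hη : ∀ i, (fun x => η x i - MvPolynomial.eval x (hp i)) =o[𝓝 0] fun x => ‖x‖ ^ k)
    (hN : ∀ i j, (fun x => N x i j - MvPolynomial.eval x (Np i j)) =o[𝓝 0] fun x => ‖x‖ ^ k) :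
    IsJetAt (act hp Np w) fun x => (N x).mulVec (w.eval (η x)) := by
  have h1 := act_isJetAt Np w h0
  set ηp : (Fin n → ℝ) → Fin n → ℝ := fun x i => MvPolynomial.eval x (hp i) with hηp
  have hηpc : Continuous ηp := continuous_pi fun i => (contDiff_poly (hp i)).continuous
  have hηp0 : ηp 0 = 0 := by
    funext i
    exact (eval_zero _).trans (h0 i)
  set NP : (Fin n → ℝ) → Matrix (Fin p) (Fin p) ℝ := fun x => Matrix.of fun j i => MvPolynomial.eval x (Np j i) with hNP
  have hd : (fun x => η x - ηp x) =o[𝓝 0] fun x => ‖x‖ ^ k := by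
    rw [isLittleO_pi]; exact hη
  have hw : HasStrictFDerivAt w.eval (fderiv ℝ w.eval 0) 0 :=
    (contDiff_jet w).contDiffAt.hasStrictFDerivAt (by simp)
  have hB : (fun x => w.eval (η x) - w.eval (ηp x)) =o[𝓝 0] fun x => ‖x‖ ^ k := by
    have ht : Tendsto (fun x => (η x, ηp x)) (𝓝 0) (𝓝 ((0 : Fin n → ℝ), (0 : Fin n → ℝ))) := by
      have a := hηc.tendsto
      have b := (hηpc.tendsto 0)
      rw [hη0] at a
      rw [hηp0] at b
      rw [nhds_prod_eq]
      exact a.prodMk b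
    have := (hw.isBigO_sub (f := w.eval)).comp_tendsto ht
    exact this.trans_isLittleO hd
  have hA : (fun x => (N x - NP x).mulVec (w.eval (η x))) =o[𝓝 0] fun x => ‖x‖ ^ k := by
    rw [isLittleO_pi]
    intro i
    simp only [Matrix.mulVec, dotProduct]
    refine IsLittleO.fun_sum fun j _ => ?_
    have hO : (fun x => w.eval (η x) j) =O[𝓝 0] fun _ => (1 : ℝ) := by
      have hc : ContinuousAt (fun x => w.eval (η x) j) 0 := by
        have h2 : ContinuousAt (fun y => w.eval y j) (η 0) :=
          ((contDiff_poly (w.1 j)).continuous).continuousAt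
        exact h2.comp hηc
      exact hc.isBigO_one ℝ
    have := (hN i j).mul_isBigO hO
    simp only [mul_one] at this
    exact this
  have hC := mulVec_littleO (M := NP)
    (Continuous.continuousAt (continuous_pi fun i => continuous_pi fun j =>
      (contDiff_poly (Np i j)).continuous)) hB
  refine ((hA.add hC).add h1).congr_left fun x => ?_
  rw [Matrix.sub_mulVec, Matrix.mulVec_sub]
  simp only [hNP, hηp]
  abel

theorem omegaK_open {k n p : ℕ} (hk : 1 ≤ k) {Ω : Set (JetSpace k n p)} (hΩ : IsOpen Ω) :
    IsOpen (OmegaK hk Ω 1) := by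
  rw [isOpen_iff_mem_nhds]
  intro w0 hw0
  obtain ⟨z0, hz0, h, M, h0, hh, hb, hM, hu, hj⟩ := omegaK_iff.1 hw0
  let e : (Fin (n+1) → ℝ) ≃L[ℝ] (Fin (n+1) → ℝ) :=
    (LinearEquiv.ofBijective (fderiv ℝ h 0).toLinearMap hb).toContinuousLinearEquiv
  have he : HasFDerivAt h (e : (Fin (n+1) → ℝ) →L[ℝ] (Fin (n+1) → ℝ)) 0 := by
    have : (e : (Fin (n+1) → ℝ) →L[ℝ] (Fin (n+1) → ℝ)) = fderiv ℝ h 0 := by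
      ext x; rfl
    rw [this]
    exact hh.diff.hasFDerivAt
  have hst : HasStrictFDerivAt h (e : (Fin (n+1) → ℝ) →L[ℝ] (Fin (n+1) → ℝ)) 0 :=
    hh.at.hasStrictFDerivAt' he (by simp)
  set η := hst.localInverse h e 0 with hηdef
  have hη0 : η 0 = 0 := by
    have := hst.localInverse_apply_image
    rwa [h0] at this
  have hleft : ∀ᶠ x in 𝓝 0, η (h x) = x := hst.eventually_left_inverse
  have hright : ∀ᶠ y in 𝓝 0, h (η y) = y := by
    have := hst.eventually_right_inverse
    rwa [h0] at this
  have hηs : ContDiffAt ℝ (⊤ : ℕ∞) η 0 := by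
    have := hh.at.to_localInverse he (by simp)
    rwa [h0] at this
  have hMi : ∀ i j, ContDiffAt ℝ (⊤ : ℕ∞) (fun x => M x i j) 0 := fun i j =>
    contDiffAt_pi.1 (contDiffAt_pi.1 hM.at i) j
  have hM0 : (M 0).det ≠ 0 := ((Matrix.isUnit_iff_isUnit_det _).1 hu).ne_zero
  have hMdet : ∀ᶠ x in 𝓝 0, (M x).det ≠ 0 := (det_cd hMi).continuousAt.eventually_ne hM0
  set N : (Fin (n+1) → ℝ) → Matrix (Fin (p+1)) (Fin (p+1)) ℝ := fun y => (M (η y))⁻¹ with hN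
  have hηt : Tendsto η (𝓝 0) (𝓝 0) := by
    have := hηs.continuousAt.tendsto
    rwa [hη0] at this
  have hNs : ∀ i j, ContDiffAt ℝ (⊤ : ℕ∞) (fun x => N x i j) 0 := by
    refine inv_cd (fun i j => ?_) (by rwa [hη0])
    have h2 : ContDiffAt ℝ (⊤ : ℕ∞) (fun x => M x i j) (η 0) := by rw [hη0]; exact hMi i j
    exact h2.comp 0 hηs
  choose hp hhp using fun i => taylor_exists k (fun x => η x i) (contDiffAt_pi.1 hηs i)
  choose Np hNp using fun i j => taylor_exists k (fun x => N x i j) (hNs i j)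
  have hhp0 : ∀ i, MvPolynomial.coeff 0 (hp i) = 0 := by
    intro i
    have := lo_at_zero (hhp i) hk
    rw [hη0, eval_zero] at this
    simpa using this
  have hT : ∀ w : JetSpace k (n+1) (p+1), IsJetAt (act hp Np w) fun x => (N x).mulVec (w.eval (η x)) :=
    fun w => act_jet_approx w hhp0 hη0 hηs.continuousAt hhp hNp
  have hTc : Continuous (fun w : JetSpace k (n+1) (p+1) => act hp Np w) := by
    rw [← continuousOn_univ]
    exact act_continuousOn (z := fun w => w) (h := fun _ => hp) (M := fun _ => Np) continuousOn_id (fun i => CP.const _) (fun i j => CP.const _)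
  have hT0 : act hp Np w0 = iPlusOne hk z0 := by
    refine jet_unique (hT w0) ?_
    have hc : ContinuousAt (fun x i j => N x i j) 0 :=
      continuousAt_pi.2 fun i => continuousAt_pi.2 fun j => (hNs i j).continuousAt
    have h1 := mulVec_littleO hc (comp_littleO hj hη0 (hηs.differentiableAt (by simp)))
    refine h1.neg_left.congr' ?_ EventuallyEq.rfl
    filter_upwards [hright, hηt.eventually hMdet] with x hx1 hx2
    rw [hx1, Matrix.mulVec_sub, Matrix.mulVec_mulVec, hN]
    simp only
    rw [Matrix.nonsing_inv_mul _ (isUnit_iff_ne_zero.2 hx2), Matrix.one_mulVec]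
    abel
  have hKE : ∀ w : JetSpace k (n+1) (p+1), KE (act hp Np w) w := by
    intro w
    refine ⟨h, M, h0, hh, hb, hM, hu, ?_⟩
    have h1 := mulVec_littleO hM.diff.continuousAt (comp_littleO (hT w) h0 hh.diff)
    refine h1.neg_left.congr' ?_ EventuallyEq.rfl
    filter_upwards [hleft, hMdet] with x hx1 hx2
    rw [hN]
    simp only
    rw [hx1, Matrix.mulVec_sub, Matrix.mulVec_mulVec,
      Matrix.mul_nonsing_inv _ (isUnit_iff_ne_zero.2 hx2), Matrix.one_mulVec]
    abel
  have hlc : Continuous (lastc (k := k) (n := n) (p := p)) := by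
    rw [← continuousOn_univ]
    exact continuousOn_jet_iff.1 continuousOn_id _ _
  have hU : IsOpen ({v : JetSpace k (n+1) (p+1) | lastc v ≠ 0} ∩ rho ⁻¹' Ω) :=
    rho_continuousOn.isOpen_inter_preimage (isOpen_ne_fun hlc continuous_const) hΩ
  have hmem : act hp Np w0 ∈ ({v : JetSpace k (n+1) (p+1) | lastc v ≠ 0} ∩ rho ⁻¹' Ω) := by
    rw [hT0]
    refine ⟨?_, ?_⟩
    · rw [Set.mem_setOf_eq, lastc_iPlusOne]; exact one_ne_zero
    · rw [Set.mem_preimage, rho_iPlusOne]; exact hz0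
  refine mem_of_superset ((hU.preimage hTc).mem_nhds hmem) fun w hw => ?_
  exact omegaK_iff.2 ⟨_, hw.2, (KE_rho hk _ hw.1).trans (hKE w)⟩


theorem space_compact {D : ℕ} (K : Geometry.SimplicialComplex ℝ (Fin D → ℝ))
    (hfin : K.faces.Finite) : IsCompact K.space :=
  hfin.isCompact_biUnion fun s _ => s.finite_toSet.isCompact_convexHull ℝ

theorem exists_small {D p : ℕ} (K L : Geometry.SimplicialComplex ℝ (Fin D → ℝ))
    (hfin : K.faces.Finite) (hsub : L.faces ⊆ K.faces)
    (hdimK : ∀ s ∈ K.faces, s.card ≤ p) (hp : 1 ≤ p)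
    (b : (Fin D → ℝ) → Fin p → ℝ) (hb : ContDiffOn ℝ (⊤ : ℕ∞) b (K.space \ L.space))
    {ε : ℝ} (hε : 0 < ε) : ∃ y : Fin p → ℝ, ‖y‖ < ε ∧ ∀ x ∈ K.space \ L.space, b x ≠ y := by
  have hLc : IsClosed L.space := (space_compact L (hfin.subset hsub)).isClosed
  have hdim : dimH (b '' (K.space \ L.space)) < Module.finrank ℝ (Fin p → ℝ) := by
    have hU : b '' (K.space \ L.space) =
        ⋃ s ∈ K.faces, b '' (convexHull ℝ (s : Set (Fin D → ℝ)) \ L.space) := by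
      rw [Geometry.SimplicialComplex.space]
      simp only [Set.iUnion_diff, Set.image_iUnion]
    rw [hU, dimH_bUnion hfin.countable]
    have hle : ⨆ s ∈ K.faces, dimH (b '' (convexHull ℝ (s : Set (Fin D → ℝ)) \ L.space)) ≤
        ((p - 1 : ℕ) : ENNReal) := by
      refine iSup₂_le fun s hs => ?_
      have h1 : dimH (b '' (convexHull ℝ (s : Set (Fin D → ℝ)) \ L.space)) ≤
          dimH (convexHull ℝ (s : Set (Fin D → ℝ)) \ L.space) := by
        apply dimH_image_le_of_locally_lipschitzOn
        intro x hx
        have hxK : x ∈ K.space \ L.space :=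
          ⟨Geometry.SimplicialComplex.convexHull_subset_space hs hx.1, hx.2⟩
        have h2 : ContDiffWithinAt ℝ 1 b (convexHull ℝ (s : Set (Fin D → ℝ)) \ L.space) x :=
          ((hb x hxK).mono (Set.diff_subset_diff_left
            (Geometry.SimplicialComplex.convexHull_subset_space hs))).of_le (by simp)
        have h3 : ContDiffWithinAt ℝ 1 b (convexHull ℝ (s : Set (Fin D → ℝ))) x := by
          rw [Set.diff_eq] at h2
          exact (contDiffWithinAt_inter (hLc.isOpen_compl.mem_nhds hx.2)).1 h2
        obtain ⟨C, t, ht, hlip⟩ := h3.exists_lipschitzOnWith (convex_convexHull ℝ _)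
        exact ⟨C, t, nhdsWithin_mono _ Set.diff_subset ht, hlip⟩
      have hne : s.Nonempty := Geometry.SimplicialComplex.nonempty_of_mem_faces hs
      have h4 : dimH (convexHull ℝ (s : Set (Fin D → ℝ))) = ((s.card - 1 : ℕ) : ENNReal) := by
        rw [Real.Convex.dimH_eq_finrank_vectorSpan (convex_convexHull ℝ _)
          (convexHull_nonempty_iff.2 hne), ← direction_affineSpan, affineSpan_convexHull,
          direction_affineSpan]
        have := (K.indep hs).finrank_vectorSpan (n := s.card - 1) (by
          rw [Fintype.card_coe]
          have := hne.card_pos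
          omega)
        rw [Subtype.range_coe_subtype] at this
        rw [← this]
        rfl
      refine h1.trans ((dimH_mono Set.diff_subset).trans ?_)
      rw [h4]
      have := hdimK s hs
      exact_mod_cast (by omega : s.card - 1 ≤ p - 1)
    refine lt_of_le_of_lt hle ?_
    rw [Module.finrank_fin_fun]
    exact_mod_cast (by omega : p - 1 < p)
  obtain ⟨y, hy, hy2⟩ := (dense_compl_of_dimH_lt_finrank hdim).exists_dist_lt 0 hε
  refine ⟨y, ?_, fun x hx hxy => hy ⟨x, hx, hxy⟩⟩
  simpa [dist_eq_norm] using hy2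

theorem real_pos {S c : ℝ} (hS : 0 ≤ S) (h : c ≤ 0 → 0 < S) :
    0 < (S + max c 0) / (1 + max (-c) 0) ∧
      0 < S + (S + max c 0) / (1 + max (-c) 0) * c := by
  rcases le_or_gt c 0 with hc | hc
  · rw [max_eq_right hc, max_eq_left (by linarith : (0 : ℝ) ≤ -c)]
    have h1 := h hc
    have h2 : 0 < 1 + -c := by linarith
    refine ⟨by positivity, ?_⟩
    have : S + (S + 0) / (1 + -c) * c = S / (1 + -c) := by field_simp; ring
    rw [this]; positivity
  · rw [max_eq_left hc.le, max_eq_right (by linarith : -c ≤ (0 : ℝ))]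
    refine ⟨by positivity, by positivity⟩

open MvPolynomial in
noncomputable def pert {k n p : ℕ} (v : JetSpace k (n+1) (p+1)) (y : Fin p → ℝ) :
    JetSpace k (n+1) (p+1) :=
  truncJet k (n+1) (p+1) fun j => v.1 j -
    C ((Fin.snoc (α := fun _ => ℝ) y 0 : Fin (p+1) → ℝ) j) * X (Fin.last n)

open MvPolynomial in
noncomputable def Mr {m p : ℕ} (a : Fin (p+1) → ℝ) : Fin (p+1) → Fin (p+1) → MvPolynomial (Fin m) ℝ :=
  fun j i => if j = Fin.last p then C (a i) else if i = j then 1 else 0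

open MvPolynomial in
noncomputable def Hr {n : ℕ} (a : Fin (n+1) → ℝ) : Fin (n+1) → MvPolynomial (Fin (n+1)) ℝ :=
  fun i => if i = Fin.last n then ∑ l, C (a l) * X l else X i

theorem pert_zero {k n p : ℕ} (v : JetSpace k (n+1) (p+1)) : pert v 0 = v := by
  rw [pert]
  conv_rhs => rw [← truncJet_self v]
  congr 1
  funext j
  have : (Fin.snoc (α := fun _ => ℝ) (0 : Fin p → ℝ) 0 : Fin (p+1) → ℝ) j = 0 := by
    refine Fin.lastCases ?_ (fun j => ?_) j
    · rw [Fin.snoc_last]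
    · rw [Fin.snoc_castSucc]; rfl
  rw [this]; simp

theorem pert_cont {X : Type*} [TopologicalSpace X] {S : Set X} {k n p : ℕ}
    {v : X → JetSpace k (n+1) (p+1)} (hv : ContinuousOn v S) {y : X → Fin p → ℝ}
    (hy : ContinuousOn y S) : ContinuousOn (fun x => pert (v x) (y x)) S := by
  rw [continuousOn_jet_iff]
  intro j
  refine CP.trunc (CP.sub (continuousOn_jet_iff.1 hv j) (CP.mul (CP.C ?_) (CP.const _))) k
  refine Fin.lastCases ?_ (fun j => ?_) j
  · simp only [Fin.snoc_last]; exact continuousOn_const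
  · simp only [Fin.snoc_castSucc]; exact continuousOn_pi.1 hy j

theorem coeff_trunc_single {k n : ℕ} (hk : 1 ≤ k) (P : MvPolynomial (Fin n) ℝ) (i : Fin n) :
    MvPolynomial.coeff (Finsupp.single i 1) (truncPoly k P) =
      MvPolynomial.coeff (Finsupp.single i 1) P := by
  rw [coeff_truncPoly, if_pos]
  rw [Finsupp.degree_single]
  exact ⟨le_refl _, hk⟩

theorem coeff_pert {k n p : ℕ} (hk : 1 ≤ k) (v : JetSpace k (n+1) (p+1)) (y : Fin p → ℝ)
    (j : Fin (p+1)) (i : Fin (n+1)) :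
    MvPolynomial.coeff (Finsupp.single i 1) ((pert v y).1 j) =
      MvPolynomial.coeff (Finsupp.single i 1) (v.1 j) -
        if i = Fin.last n then (Fin.snoc (α := fun _ => ℝ) y 0 : Fin (p+1) → ℝ) j else 0 := by
  rw [pert, truncJet, coeff_trunc_single hk, MvPolynomial.coeff_sub, MvPolynomial.coeff_C_mul,
    MvPolynomial.coeff_X]
  by_cases h : i = Fin.last n
  · subst h; simp
  · rw [if_neg h, if_neg (fun h' => h ((Finsupp.single_left_inj one_ne_zero).1 h').symm), mul_zero]

theorem Mr_det {m p : ℕ} (a : Fin (p+1) → ℝ) (ha : a (Fin.last p) ≠ 0) :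
    (Matrix.of fun j i => MvPolynomial.coeff 0 (Mr (m := m) a j i)).det ≠ 0 := by
  rw [Matrix.det_of_lowerTriangular]
  · refine Finset.prod_ne_zero_iff.2 fun i _ => ?_
    by_cases hi : i = Fin.last p
    · subst hi
      simp [Mr, ha]
    · simp [Mr, hi]
  · intro i j hij
    have hij : i < j := hij
    have h1 : i ≠ Fin.last p := (lt_of_lt_of_le hij (Fin.le_last j)).ne
    simp [Mr, h1, hij.ne']

theorem coeff_Hr {n : ℕ} (a : Fin (n+1) → ℝ) (i j : Fin (n+1)) :
    MvPolynomial.coeff (Finsupp.single j 1) (Hr a i) =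
      if i = Fin.last n then a j else if i = j then 1 else 0 := by
  rw [Hr]
  split_ifs with h1 h2
  · rw [MvPolynomial.coeff_sum]
    simp [MvPolynomial.coeff_C_mul, MvPolynomial.coeff_X, Finsupp.single_left_inj]
  · rw [h2]; simp [MvPolynomial.coeff_X]
  · simp [MvPolynomial.coeff_X, Finsupp.single_left_inj, h2]

theorem Hr_zero {n : ℕ} (a : Fin (n+1) → ℝ) (i : Fin (n+1)) : MvPolynomial.coeff 0 (Hr a i) = 0 := by
  rw [Hr]
  split_ifs with h1
  · rw [MvPolynomial.coeff_sum]
    simp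
  · simp

theorem Hr_det {n : ℕ} (a : Fin (n+1) → ℝ) (ha : a (Fin.last n) ≠ 0) : (linM (Hr a)).det ≠ 0 := by
  rw [Matrix.det_of_lowerTriangular]
  · refine Finset.prod_ne_zero_iff.2 fun i _ => ?_
    simp only [linM, Matrix.of_apply, coeff_Hr]
    by_cases hi : i = Fin.last n
    · subst hi
      simpa using ha
    · simp [hi]
  · intro i j hij
    have hij : i < j := hij
    have h1 : i ≠ Fin.last n := (lt_of_lt_of_le hij (Fin.le_last j)).ne
    simp only [linM, Matrix.of_apply, coeff_Hr, if_neg h1, if_neg hij.ne]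

theorem act_id {k n p : ℕ} (v : JetSpace k (n+1) (p+1)) {a : Fin (n+1) → ℝ} {c : Fin (p+1) → ℝ}
    (ha : ∀ i, a i = if i = Fin.last n then 1 else 0)
    (hc : ∀ i, c i = if i = Fin.last p then 1 else 0) : act (Hr a) (Mr c) v = v := by
  have hH : Hr a = MvPolynomial.X := by
    funext i
    rw [Hr]
    split_ifs with h
    · simp [ha, h]
    · rfl
  have hM : ∀ j i, Mr (m := n+1) c j i = if i = j then 1 else 0 := by
    intro j i
    rw [Mr]
    by_cases h : j = Fin.last p
    · rw [if_pos h, hc, h]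
      split_ifs <;> simp
    · rw [if_neg h]
  rw [act]
  conv_rhs => rw [← truncJet_self v]
  congr 1
  funext j
  rw [hH]
  simp only [hM, MvPolynomial.aeval_X_left, ite_mul, one_mul, zero_mul, Finset.sum_ite_eq',
    Finset.mem_univ, if_true]
  rfl

theorem coeff_act_last {k n p : ℕ} (hk : 1 ≤ k) (v : JetSpace k (n+1) (p+1)) (a : Fin (n+1) → ℝ)
    (c : Fin (p+1) → ℝ) (i : Fin (n+1)) :
    MvPolynomial.coeff (Finsupp.single i 1) ((act (Hr a) (Mr c) v).1 (Fin.last p)) =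
      ∑ m, (∑ l, c l * MvPolynomial.coeff (Finsupp.single m 1) (v.1 l)) *
        (if m = Fin.last n then a i else if m = i then 1 else 0) := by
  rw [act, truncJet, coeff_trunc_single hk, MvPolynomial.coeff_sum]
  simp only [Mr, if_true, MvPolynomial.coeff_C_mul, coeff_single_aeval (Hr_zero a), coeff_Hr]
  simp only [Finset.mul_sum, Finset.sum_mul]
  rw [Finset.sum_comm]
  refine Finset.sum_congr rfl fun m _ => Finset.sum_congr rfl fun l _ => ?_
  ring

theorem tube_gen {X Y Z : Type*} [TopologicalSpace X] [NormedAddCommGroup Y] [TopologicalSpace Z]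
    {S : Set X} (hS : IsCompact S) {F : X → Y → Z}
    (hF : Continuous fun q : S × Y => F q.1 q.2)
    {U : Set Z} (hU : IsOpen U) (hm : ∀ x ∈ S, F x 0 ∈ U) :
    ∃ ε : ℝ, 0 < ε ∧ ∀ x ∈ S, ∀ y : Y, ‖y‖ < ε → F x y ∈ U := by
  have : CompactSpace S := isCompact_iff_compactSpace.1 hS
  have hW := hU.preimage hF
  have hsub : (Set.univ : Set S) ×ˢ {(0 : Y)} ⊆
      (fun q : S × Y => F q.1 q.2) ⁻¹' U := by
    intro q hq
    have hy : q.2 = 0 := Set.mem_singleton_iff.1 (Set.mem_prod.1 hq).2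
    rw [Set.mem_preimage, hy]
    exact hm _ q.1.2
  obtain ⟨A, B, hA, hB, hA1, hB1, hAB⟩ := generalized_tube_lemma (isCompact_univ (X := S))
    (isCompact_singleton (x := (0 : Y))) hW hsub
  obtain ⟨ε, hε, hb⟩ := Metric.isOpen_iff.1 hB 0 (hB1 (Set.mem_singleton _))
  refine ⟨ε, hε, fun x hx y hy => ?_⟩
  have hyB : y ∈ B := hb (mem_ball_zero_iff.2 hy)
  have h3 : ((⟨x, hx⟩ : S), y) ∈ A ×ˢ B := Set.mk_mem_prod (hA1 (Set.mem_univ _)) hyB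
  exact Set.mem_preimage.1 (hAB h3)

theorem tube {D k n p : ℕ} {S : Set (Fin D → ℝ)} (hS : IsCompact S)
    {ψ : (Fin D → ℝ) → JetSpace k (n+1) (p+1)} (hψ : ContinuousOn ψ S)
    {U : Set (JetSpace k (n+1) (p+1))} (hU : IsOpen U) (hm : Set.MapsTo ψ S U) :
    ∃ ε : ℝ, 0 < ε ∧ ∀ x ∈ S, ∀ y : Fin p → ℝ, ‖y‖ < ε → pert (ψ x) y ∈ U := by
  refine tube_gen (F := fun x y => pert (ψ x) y) hS ?_ hU ?_
  · have h1 : Continuous (fun x : S => ψ x) := continuousOn_iff_continuous_restrict.1 hψ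
    have h2 : ContinuousOn (fun q : S × (Fin p → ℝ) => ψ q.1) Set.univ :=
      (h1.comp continuous_fst).continuousOn
    have h3 : ContinuousOn (fun q : S × (Fin p → ℝ) => q.2) Set.univ := continuousOn_snd
    exact continuousOn_univ.1 (pert_cont (v := fun q : S × (Fin p → ℝ) => ψ q.1)
      (y := fun q : S × (Fin p → ℝ) => q.2) h2 h3)
  · intro x hx
    rw [pert_zero]
    exact hm hx


section
variable {k n p : ℕ}

noncomputable def bv (v : JetSpace k (n+1) (p+1)) : Fin p → ℝ := fun j =>
  MvPolynomial.coeff (Finsupp.single (Fin.last n) 1) (v.1 j.castSucc)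

noncomputable def chi (v : JetSpace k (n+1) (p+1)) : ℝ := max 0 (min 1 (1 - lastc v))

noncomputable def bt (v : JetSpace k (n+1) (p+1)) (y : Fin p → ℝ) (j : Fin p) : ℝ :=
  bv v j - chi v * y j

noncomputable def SS (v : JetSpace k (n+1) (p+1)) (y : Fin p → ℝ) : ℝ := ∑ j, bt v y j * bt v y j

noncomputable def dd (v : JetSpace k (n+1) (p+1)) (y : Fin p → ℝ) : ℝ :=
  (SS v y + max (lastc v) 0) / (1 + max (-lastc v) 0)

noncomputable def cvec (t : ℝ) (v : JetSpace k (n+1) (p+1)) (y : Fin p → ℝ) : Fin (p+1) → ℝ :=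
  Fin.snoc (α := fun _ => ℝ) (fun j => t * bt v y j) (1 - t + t * dd v y)

noncomputable def rr (v : JetSpace k (n+1) (p+1)) (y : Fin p → ℝ) (i : Fin (n+1)) : ℝ :=
  ∑ l, cvec 1 v y l * MvPolynomial.coeff (Finsupp.single i 1) ((pert v (chi v • y)).1 l)

noncomputable def avec (t : ℝ) (v : JetSpace k (n+1) (p+1)) (y : Fin p → ℝ) : Fin (n+1) → ℝ :=
  fun l => if l = Fin.last n then 1 - t + t * (rr v y (Fin.last n))⁻¹
    else -t * rr v y l * (rr v y (Fin.last n))⁻¹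

noncomputable def Phi (t : ℝ) (v : JetSpace k (n+1) (p+1)) (y : Fin p → ℝ) :
    JetSpace k (n+1) (p+1) :=
  act (Hr (avec t v y)) (Mr (cvec t v y)) (pert v ((t * chi v) • y))

theorem chi_nonneg (v : JetSpace k (n+1) (p+1)) : 0 ≤ chi v := le_max_left _ _
theorem chi_le (v : JetSpace k (n+1) (p+1)) : chi v ≤ 1 := max_le zero_le_one (min_le_left _ _)
theorem chi_one {v : JetSpace k (n+1) (p+1)} (h : lastc v ≤ 0) : chi v = 1 := by
  rw [chi, min_eq_left (by linarith), max_eq_right zero_le_one]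
theorem SS_nonneg (v : JetSpace k (n+1) (p+1)) (y : Fin p → ℝ) : 0 ≤ SS v y :=
  Finset.sum_nonneg fun _ _ => mul_self_nonneg _

theorem rr_last (hk : 1 ≤ k) (v : JetSpace k (n+1) (p+1)) (y : Fin p → ℝ) :
    rr v y (Fin.last n) = SS v y + dd v y * lastc v := by
  rw [rr, Fin.sum_univ_castSucc]
  simp only [cvec, Fin.snoc_last, Fin.snoc_castSucc, coeff_pert hk, if_true]
  rw [SS, lastc]
  congr 1
  · refine Finset.sum_congr rfl fun j _ => ?_
    simp only [bt, bv, Pi.smul_apply, smul_eq_mul, one_mul]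
  · ring

theorem good (hk : 1 ≤ k) {v : JetSpace k (n+1) (p+1)} {y : Fin p → ℝ}
    (h : lastc v ≤ 0 → bv v ≠ y) : 0 < dd v y ∧ 0 < rr v y (Fin.last n) := by
  rw [rr_last hk]
  refine real_pos (SS_nonneg v y) fun hc => ?_
  refine (SS_nonneg v y).lt_of_ne' fun h0 => h hc ?_
  rw [SS, Finset.sum_eq_zero_iff_of_nonneg fun _ _ => mul_self_nonneg _] at h0
  funext j
  have := mul_self_eq_zero.1 (h0 j (Finset.mem_univ _))
  rw [bt, chi_one hc] at this
  linarith

theorem bv_iPlusOne (hk : 1 ≤ k) (z : JetSpace k n p) : bv (iPlusOne hk z) = 0 := by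
  funext j
  rw [bv, iPlusOne_castSucc, coeff_last_rename]; rfl

theorem Phi_zero (v : JetSpace k (n+1) (p+1)) (y : Fin p → ℝ) : Phi 0 v y = v := by
  rw [Phi, zero_mul, zero_smul, pert_zero]
  refine act_id v (fun i => ?_) (fun i => ?_)
  · rw [avec]; simp
  · rw [cvec]
    refine Fin.lastCases ?_ (fun j => ?_) i
    · simp
    · simp [Fin.snoc_castSucc, (Fin.castSucc_lt_last j).ne]

theorem Phi_fix (hk : 1 ≤ k) (t : ℝ) (z : JetSpace k n p) (y : Fin p → ℝ) :
    Phi t (iPlusOne hk z) y = iPlusOne hk z := by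
  have hchi : chi (iPlusOne hk z) = 0 := by rw [chi, lastc_iPlusOne]; simp
  have hbt : ∀ j, bt (iPlusOne hk z) y j = 0 := fun j => by
    rw [bt, bv_iPlusOne, hchi]; simp
  have hSS : SS (iPlusOne hk z) y = 0 := by rw [SS]; simp [hbt]
  have hd : dd (iPlusOne hk z) y = 1 := by rw [dd, hSS, lastc_iPlusOne]; norm_num
  have hc : ∀ t i, cvec t (iPlusOne hk z) y i = if i = Fin.last p then 1 else 0 := by
    intro t i
    rw [cvec]
    refine Fin.lastCases ?_ (fun j => ?_) i
    · simp [hd]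
    · simp [Fin.snoc_castSucc, (Fin.castSucc_lt_last j).ne, hbt]
  have hr : ∀ i, rr (iPlusOne hk z) y i = if i = Fin.last n then 1 else 0 := by
    intro i
    rw [rr]
    simp only [hc, ite_mul, one_mul, zero_mul, Finset.sum_ite_eq', Finset.sum_ite_eq,
      Finset.mem_univ, if_true]
    rw [hchi, zero_smul, pert_zero, iPlusOne_last, MvPolynomial.coeff_X]
    simp [Finsupp.single_left_inj, eq_comm]
  rw [Phi, hchi, mul_zero, zero_smul, pert_zero]
  refine act_id _ (fun i => ?_) (hc t)
  rw [avec]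
  simp only [hr, if_true]
  split_ifs <;> simp

theorem Phi_last (hk : 1 ≤ k) {v : JetSpace k (n+1) (p+1)} {y : Fin p → ℝ}
    (h : 0 < rr v y (Fin.last n)) (i : Fin (n+1)) :
    MvPolynomial.coeff (Finsupp.single i 1) ((Phi 1 v y).1 (Fin.last p)) =
      if i = Fin.last n then 1 else 0 := by
  rw [Phi, coeff_act_last hk, one_mul]
  have : ∀ m, (∑ l, cvec 1 v y l * MvPolynomial.coeff (Finsupp.single m 1)
      ((pert v (chi v • y)).1 l)) = rr v y m := fun m => rfl
  simp only [this]
  rw [Fin.sum_univ_castSucc]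
  simp only [if_true, (Fin.castSucc_lt_last _).ne, if_false, avec]
  refine Fin.lastCases ?_ (fun j => ?_) i
  · simp [(Fin.castSucc_lt_last _).ne, h.ne']
  · simp only [(Fin.castSucc_lt_last _).ne, if_false, Fin.castSucc_inj, mul_ite, mul_one, mul_zero,
      Finset.sum_ite_eq', Finset.mem_univ, if_true]
    field_simp
    ring

theorem Phi_KE {t : ℝ} (ht : t ∈ Set.Icc (0:ℝ) 1) {v : JetSpace k (n+1) (p+1)}
    {y : Fin p → ℝ} (h : 0 < dd v y ∧ 0 < rr v y (Fin.last n)) :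
    KE (pert v ((t * chi v) • y)) (Phi t v y) := by
  have key : ∀ d : ℝ, 0 < d → 1 - t + t * d ≠ 0 := by
    intro d hd
    have h1 := ht.1
    have h2 := ht.2
    have h3 := mul_nonneg h1 hd.le
    intro h0
    have h4 : t = 1 := by linarith
    rw [h4] at h0
    linarith
  refine KE.act _ (Hr_zero _) (Hr_det _ ?_) (Mr_det _ ?_)
  · rw [avec, if_pos rfl]
    exact key _ (inv_pos.2 h.2)
  · rw [cvec, Fin.snoc_last]
    exact key _ h.1

theorem coeff_co {X : Type*} [TopologicalSpace X] {S : Set X}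
    {v : X → JetSpace k (n+1) (p+1)} (hv : ContinuousOn v S) (j : Fin (p+1)) (d : Fin (n+1) →₀ ℕ) :
    ContinuousOn (fun x => MvPolynomial.coeff d ((v x).1 j)) S :=
  continuousOn_jet_iff.1 hv j d

theorem Phi_cont {X : Type*} [TopologicalSpace X] {S : Set X}
    {v : X → JetSpace k (n+1) (p+1)} (hv : ContinuousOn v S) {t : X → ℝ} (ht : ContinuousOn t S)
    (y : Fin p → ℝ) (hr : ∀ x ∈ S, rr (v x) y (Fin.last n) ≠ 0) :
    ContinuousOn (fun x => Phi (t x) (v x) y) S := by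
  have hl : ContinuousOn (fun x => lastc (v x)) S := coeff_co hv _ _
  have hchi : ContinuousOn (fun x => chi (v x)) S :=
    continuousOn_const.sup (continuousOn_const.inf (continuousOn_const.sub hl))
  have hbt : ∀ j, ContinuousOn (fun x => bt (v x) y j) S := fun j =>
    (coeff_co hv j.castSucc _).sub (hchi.mul continuousOn_const)
  have hSS : ContinuousOn (fun x => SS (v x) y) S :=
    continuousOn_finsetSum _ fun j _ => (hbt j).mul (hbt j)
  have hdd : ContinuousOn (fun x => dd (v x) y) S := by
    refine ContinuousOn.div (hSS.add (hl.sup continuousOn_const))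
      (continuousOn_const.add (hl.neg.sup continuousOn_const)) fun x _ => ?_
    have : (0:ℝ) ≤ max (-lastc (v x)) 0 := le_max_right _ _
    positivity
  have hc : ∀ (s : X → ℝ), ContinuousOn s S → ∀ l,
      ContinuousOn (fun x => cvec (s x) (v x) y l) S := by
    intro s hs l
    refine Fin.lastCases ?_ (fun j => ?_) l
    · simp only [cvec, Fin.snoc_last]
      exact (continuousOn_const.sub hs).add (hs.mul hdd)
    · simp only [cvec, Fin.snoc_castSucc]
      exact hs.mul (hbt j)
  have hp1 : ContinuousOn (fun x => pert (v x) (chi (v x) • y)) S :=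
    pert_cont (v := v) (y := fun x => chi (v x) • y) hv (hchi.smul continuousOn_const)
  have hrr : ∀ i, ContinuousOn (fun x => rr (v x) y i) S := fun i =>
    continuousOn_finsetSum _ fun l _ => (hc (fun _ => 1) continuousOn_const l).mul
      (coeff_co (v := fun x => pert (v x) (chi (v x) • y)) hp1 l _)
  have hri := (hrr (Fin.last n)).inv₀ hr
  have ha : ∀ l, ContinuousOn (fun x => avec (t x) (v x) y l) S := by
    intro l
    by_cases h : l = Fin.last n
    · simp only [avec, if_pos h]
      exact (continuousOn_const.sub ht).add (ht.mul hri)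
    · simp only [avec, if_neg h]
      exact (ht.neg.mul (hrr l)).mul hri
  have hp2 : ContinuousOn (fun x => pert (v x) ((t x * chi (v x)) • y)) S :=
    pert_cont (v := v) (y := fun x => (t x * chi (v x)) • y) hv
      ((ht.mul hchi).smul continuousOn_const)
  refine act_continuousOn (z := fun x => pert (v x) ((t x * chi (v x)) • y))
    (h := fun x => Hr (avec (t x) (v x) y)) (M := fun x => Mr (cvec (t x) (v x) y)) hp2 ?_ ?_
  · intro i
    by_cases h : i = Fin.last n
    · simp only [Hr, if_pos h]
      exact CP.sum (F := fun l x => MvPolynomial.C (avec (t x) (v x) y l) * MvPolynomial.X l)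
        fun l _ => CP.mul (CP.C (ha l)) (CP.const _)
    · simp only [Hr, if_neg h]
      exact CP.const _
  · intro i j
    by_cases h : i = Fin.last p
    · simp only [Mr, if_pos h]
      exact CP.C (hc t ht j)
    · simp only [Mr, if_neg h]
      exact CP.const _

theorem bv_smooth (hk : 1 ≤ k) {D : ℕ} {ψ : (Fin D → ℝ) → JetSpace k (n+1) (p+1)}
    {S : Set (Fin D → ℝ)} (h : ContDiffOn ℝ (⊤ : ℕ∞) (fun x => jetCoeffs (ψ x)) S) :
    ContDiffOn ℝ (⊤ : ℕ∞) (fun x => bv (ψ x)) S := by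
  rw [contDiffOn_pi]
  intro j
  have h1 := contDiffOn_pi.1 (contDiffOn_pi.1 h j.castSucc)
    (Pi.single (Fin.last n) (⟨1, by omega⟩ : Fin (k+1)))
  have h2 : (Finsupp.equivFunOnFinite.symm fun i : Fin (n+1) =>
      (((Pi.single (Fin.last n) (⟨1, by omega⟩ : Fin (k+1)) : Fin (n+1) → Fin (k+1)) i : Fin (k+1)) : ℕ)) =
      Finsupp.single (Fin.last n) 1 := by
    ext i
    simp only [Finsupp.equivFunOnFinite_symm_apply_apply, Finsupp.single_apply, Pi.single_apply, eq_comm]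
    split_ifs <;> rfl
  simp only [jetCoeffs, h2] at h1
  exact h1
end

theorem lemma_6_1 (k n p D : ℕ) (hk : 1 ≤ k)
    (Ω : Set (JetSpace k n p)) (hΩopen : IsOpen Ω) (hΩinv : KInvariant Ω)
    (K L : Geometry.SimplicialComplex ℝ (Fin D → ℝ))
    (hfin : K.faces.Finite) (hsub : L.faces ⊆ K.faces)
    (hdimK : ∀ s ∈ K.faces, s.card ≤ p)
    (hdimL : ∃ dK : ℕ, (∀ s ∈ K.faces, s.card ≤ dK + 1) ∧
      (∃ s ∈ K.faces, s.card = dK + 1) ∧ ∀ s ∈ L.faces, s.card ≤ dK)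
    (hmfd : ∃ d : ℕ, Nonempty
      (ChartedSpace (EuclideanSpace ℝ (Fin d)) ↥(K.space \ L.space)))
    (ψ : (Fin D → ℝ) → JetSpace k (n + 1) (p + 1))
    (hψc : ContinuousOn ψ K.space)
    (hψK : Set.MapsTo ψ K.space (OmegaK hk Ω 1))
    (hψL : Set.MapsTo ψ L.space (iPlusOne hk '' Ω))
    (hψsm : ContDiffOn ℝ (⊤ : ℕ∞) (fun x => jetCoeffs (ψ x)) (K.space \ L.space)) :
    ∃ Ψ : ℝ → (Fin D → ℝ) → JetSpace k (n + 1) (p + 1),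
      ContinuousOn (fun q : ℝ × (Fin D → ℝ) => Ψ q.1 q.2)
        (Set.Icc (0 : ℝ) 1 ×ˢ K.space) ∧
      (∀ x ∈ K.space, Ψ 0 x = ψ x) ∧
      (∀ t ∈ Set.Icc (0 : ℝ) 1, Set.MapsTo (Ψ t) K.space (OmegaK hk Ω 1)) ∧
      (∀ t ∈ Set.Icc (0 : ℝ) 1, Set.MapsTo (Ψ t) L.space (iPlusOne hk '' Ω)) ∧
      (∀ t ∈ Set.Icc (0 : ℝ) 1, ∀ x ∈ L.space, Ψ t x = ψ x) ∧
      ∀ x ∈ K.space, ∀ i : Fin (n + 1),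
        MvPolynomial.coeff (Finsupp.single i 1) ((Ψ 1 x).1 (Fin.last p)) =
          (if i = Fin.last n then 1 else 0) := by
  have hp : 1 ≤ p := by
    obtain ⟨dK, _, ⟨s, hs, hsc⟩, _⟩ := hdimL
    have := hdimK s hs
    omega
  obtain ⟨ε, hε, htube⟩ := tube (space_compact K hfin) hψc (omegaK_open hk hΩopen) hψK
  obtain ⟨y, hy, hyb⟩ := exists_small K L hfin hsub hdimK hp (fun x => bv (ψ x))
    (bv_smooth hk hψsm) hε
  have hgood : ∀ x ∈ K.space, 0 < dd (ψ x) y ∧ 0 < rr (ψ x) y (Fin.last n) := by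
    intro x hx
    refine good hk fun hc => ?_
    refine hyb x ⟨hx, fun hxL => ?_⟩
    obtain ⟨z, _, hz⟩ := hψL hxL
    rw [← hz, lastc_iPlusOne] at hc
    linarith
  have hfix : ∀ t : ℝ, ∀ x ∈ L.space, Phi t (ψ x) y = ψ x := by
    intro t x hx
    obtain ⟨z, _, hz⟩ := hψL hx
    rw [← hz, Phi_fix]
  refine ⟨fun t x => Phi t (ψ x) y, ?_, fun x _ => Phi_zero _ _, ?_, ?_, fun t _ => hfix t, ?_⟩
  · refine Phi_cont (v := fun q : ℝ × (Fin D → ℝ) => ψ q.2) (t := fun q : ℝ × (Fin D → ℝ) => q.1)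
      (hψc.comp continuousOn_snd fun q hq => hq.2) continuousOn_fst y fun q hq => ?_
    exact (hgood q.2 hq.2).2.ne'
  · intro t ht x hx
    have h1 : pert (ψ x) ((t * chi (ψ x)) • y) ∈ OmegaK hk Ω 1 := by
      refine htube x hx _ (lt_of_le_of_lt ?_ hy)
      have h0 := mul_nonneg ht.1 (chi_nonneg (ψ x))
      rw [norm_smul, Real.norm_eq_abs, abs_of_nonneg h0]
      exact mul_le_of_le_one_left (norm_nonneg _)
        (mul_le_one₀ ht.2 (chi_nonneg _) (chi_le _))
    obtain ⟨z, hz, hKE⟩ := omegaK_iff.1 h1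
    exact omegaK_iff.2 ⟨z, hz, hKE.trans (Phi_KE ht (hgood x hx))⟩
  · intro t _ x hx
    have := hψL hx
    rw [← hfix t x hx] at this
    exact this
  · intro x hx i
    exact Phi_last hk (hgood x hx).2 i


end AndoCob
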